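/- arXiv:1112.2217 — 7 statements merged into one kernel-verified Lean document; each statement's English description precedes it below -/
import Mathlib

section
/- Let d ∈ ℕ and let F : ℝ^d → ℝ^d be continuously differentiable with trace(DF(x)) = 0 for every x (F is divergence-free). Suppose φ : ℝ × ℝ^d → ℝ^d satisfies φ(0, x) = x and ∂_t φ(t, x) = F(φ(t, x)) for all (t, x), and that for each t the map φ(t, ·) is a C¹ diffeomorphism of ℝ^d. Then for each t ∈ ℝ the map φ(t, ·) preserves Lebesgue measure: for every Lebesgue-measurable set A ⊆ ℝ^d, vol(φ(t, ·)⁻¹(A)) = vol(A) (Liouville's theorem). -/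
open MeasureTheory

open Filter Topology Set

section Flow

variable {E : Type*} [NormedAddCommGroup E] [NormedSpace ℝ E]

/-- Two global integral curves of a `C¹` vector field that meet at one time coincide. -/
lemma eq_of_hasDerivAt_of_contDiff {F : E → E} (hF : ContDiff ℝ 1 F) {f g : ℝ → E}
    (hf : ∀ t, HasDerivAt f (F (f t)) t) (hg : ∀ t, HasDerivAt g (F (g t)) t) {t₀ : ℝ}
    (h₀ : f t₀ = g t₀) : f = g := by
  have hfc : Continuous f := continuous_iff_continuousAt.2 fun t => (hf t).continuousAt
  have hgc : Continuous g := continuous_iff_continuousAt.2 fun t => (hg t).continuousAt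
  have hclosed : IsClosed {t | f t = g t} := isClosed_eq hfc hgc
  have hopen : IsOpen {t | f t = g t} := by
    refine isOpen_iff_mem_nhds.2 fun t ht => ?_
    obtain ⟨K, s, hs, hK⟩ := (hF.contDiffAt (x := f t)).exists_lipschitzOnWith
    have hs' : s ∈ 𝓝 (g t) := by rwa [← show f t = g t from ht]
    exact ODE_solution_unique_of_eventually (v := fun _ => F) (s := fun _ => s)
      (Eventually.of_forall fun _ => hK)
      (((hfc.tendsto t).eventually hs).mono fun τ hτ => ⟨hf τ, hτ⟩)
      (((hgc.tendsto t).eventually hs').mono fun τ hτ => ⟨hg τ, hτ⟩) ht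
  have huniv := IsClopen.eq_univ ⟨hclosed, hopen⟩ ⟨t₀, h₀⟩
  funext t
  exact (huniv ▸ mem_univ t : t ∈ {t | f t = g t})

/-- The group law of a global flow of a `C¹` vector field. -/
lemma flow_add {F : E → E} (hF : ContDiff ℝ 1 F) {φ : ℝ → E → E} (hφ0 : ∀ x, φ 0 x = x)
    (hφ' : ∀ t x, HasDerivAt (fun τ => φ τ x) (F (φ t x)) t) (t s : ℝ) (x : E) :
    φ (t + s) x = φ t (φ s x) := by
  refine congrFun (eq_of_hasDerivAt_of_contDiff hF (f := fun τ => φ (τ + s) x)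
    (g := fun τ => φ τ (φ s x)) (fun τ => ?_) (fun τ => hφ' τ _) (t₀ := 0) ?_) t
  · exact (hφ' (τ + s) x).comp_add_const τ s
  · simp [hφ0]

/-- An integral curve starting in the ball of radius `R` stays in the ball of radius `R + 1` for a
time controlled by the size of the vector field there. -/
lemma norm_le_add_one_of_hasDerivAt {F : E → E} {f : ℝ → E}
    (hf : ∀ t, HasDerivAt f (F (f t)) t) {R M : ℝ} (hM : 0 ≤ M) (hR : ‖f 0‖ ≤ R)
    (hFM : ∀ y, ‖y‖ ≤ R + 1 → ‖F y‖ ≤ M) {s : ℝ} (hs0 : 0 ≤ s) (hs : s ≤ (M + 1)⁻¹) :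
    ‖f s‖ ≤ R + 1 := by
  have hM1 : 0 < M + 1 := by linarith
  have hle : ∀ x, x ≤ (M + 1)⁻¹ → (M + 1) * x ≤ 1 := fun x hx => by
    calc (M + 1) * x ≤ (M + 1) * (M + 1)⁻¹ := by gcongr
      _ = 1 := mul_inv_cancel₀ hM1.ne'
  have key := image_norm_le_of_norm_deriv_right_lt_deriv_boundary (a := 0) (b := (M + 1)⁻¹)
    (f := f) (f' := fun t => F (f t)) (B := fun t => R + (M + 1) * t) (B' := fun _ => M + 1)
    (fun t _ => (hf t).continuousAt.continuousWithinAt)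
    (fun t _ => (hf t).hasDerivWithinAt) (by simpa using hR)
    (fun t => by simpa using ((hasDerivAt_id t).const_mul (M + 1)).const_add R)
    (fun t ht heq => by
      have := hle t ht.2.le
      have := hFM (f t) (by rw [heq]; linarith)
      linarith) ⟨hs0, hs⟩
  have := hle s hs
  linarith

/-- The preimage of a bounded set under a flow is bounded, uniformly for short times. -/
lemma exists_norm_le_of_flow_norm_le [ProperSpace E] {F : E → E} (hF : ContDiff ℝ 1 F)
    {φ : ℝ → E → E} (hφ0 : ∀ x, φ 0 x = x)
    (hφ' : ∀ t x, HasDerivAt (fun τ => φ τ x) (F (φ t x)) t) (R : ℝ) :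
    ∃ ε > 0, ∀ s x, |s| < ε → ‖φ s x‖ ≤ R → ‖x‖ ≤ R + 1 := by
  obtain ⟨C, hC⟩ := (isCompact_closedBall (0 : E) (R + 1)).exists_bound_of_continuousOn
    hF.continuous.continuousOn
  have hFM : ∀ y, ‖y‖ ≤ R + 1 → ‖F y‖ ≤ max C 0 := fun y hy =>
    (hC y (by simpa using hy)).trans (le_max_left _ _)
  refine ⟨(max C 0 + 1)⁻¹, by positivity, fun s x hs hx => ?_⟩
  have hback : φ (-s) (φ s x) = x := by rw [← flow_add hF hφ0 hφ']; simp [hφ0]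
  rcases le_total 0 s with h | h
  · have := norm_le_add_one_of_hasDerivAt (F := fun y => -F y) (f := fun τ => φ (-τ) (φ s x))
      (fun t => by
        simpa [Function.comp_def] using (hφ' (-t) (φ s x)).scomp t (hasDerivAt_neg t))
      (le_max_right C 0) (by simpa [hφ0] using hx) (by simpa using hFM) h
      ((le_abs_self s).trans hs.le)
    simpa only [hback] using this
  · have := norm_le_add_one_of_hasDerivAt (f := fun τ => φ τ (φ s x))
      (fun t => hφ' t (φ s x))
      (le_max_right C 0) (by simpa [hφ0] using hx) hFM (neg_nonneg.2 h)
      ((neg_le_abs s).trans hs.le)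
    simpa only [hback] using this

end Flow

section Liouville

variable {E : Type*} [NormedAddCommGroup E] [InnerProductSpace ℝ E] [FiniteDimensional ℝ E]
  [MeasurableSpace E] [BorelSpace E] {μ : Measure E} [μ.IsAddHaarMeasure]

/-- A divergence-free vector field is orthogonal to compactly supported gradients. -/
lemma integral_fderiv_apply_eq_zero_of_trace_eq_zero {F : E → E} (hF : ContDiff ℝ 1 F)
    (hdiv : ∀ x, LinearMap.trace ℝ E (fderiv ℝ F x).toLinearMap = 0) {h : E → ℝ}
    (hh : ContDiff ℝ 1 h) (hc : HasCompactSupport h) :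
    ∫ x, fderiv ℝ h x (F x) ∂μ = 0 := by
  set b := stdOrthonormalBasis ℝ E
  have hFd := hF.differentiable one_ne_zero
  have hG : ∀ i, ContDiff ℝ 1 fun x => inner ℝ (b i) (F x) := fun i => contDiff_const.inner ℝ hF
  have hGd : ∀ i x, fderiv ℝ (fun x => inner ℝ (b i) (F x)) x (b i)
      = inner ℝ (b i) (fderiv ℝ F x (b i)) := fun i x => by
    rw [fderiv_inner_apply ℝ (differentiableAt_const _) (hFd x)]
    simp
  have hint1 : ∀ i, Integrable (fun x => fderiv ℝ h x (b i) * inner ℝ (b i) (F x)) μ := fun i =>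
    (((hh.continuous_fderiv one_ne_zero).clm_apply continuous_const).mul
      (hG i).continuous).integrable_of_hasCompactSupport ((hc.fderiv_apply ℝ _).mul_right)
  have hint2 : ∀ i, Integrable
      (fun x => h x * fderiv ℝ (fun x => inner ℝ (b i) (F x)) x (b i)) μ := fun i =>
    (hh.continuous.mul (((hG i).continuous_fderiv one_ne_zero).clm_apply
      continuous_const)).integrable_of_hasCompactSupport hc.mul_right
  have hint3 : ∀ i, Integrable (fun x => h x * inner ℝ (b i) (F x)) μ := fun i =>
    (hh.continuous.mul (hG i).continuous).integrable_of_hasCompactSupport hc.mul_right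
  calc ∫ x, fderiv ℝ h x (F x) ∂μ
      = ∫ x, ∑ i, fderiv ℝ h x (b i) * inner ℝ (b i) (F x) ∂μ := by
        congr 1 with x
        conv_lhs => rw [← b.sum_repr' (F x)]
        simp [mul_comm]
    _ = ∑ i, ∫ x, fderiv ℝ h x (b i) * inner ℝ (b i) (F x) ∂μ :=
        integral_finsetSum _ fun i _ => hint1 i
    _ = -∑ i, ∫ x, h x * fderiv ℝ (fun x => inner ℝ (b i) (F x)) x (b i) ∂μ := by
        rw [← Finset.sum_neg_distrib]
        refine Finset.sum_congr rfl fun i _ => ?_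
        rw [integral_mul_fderiv_eq_neg_fderiv_mul_of_integrable (hint1 i) (hint2 i) (hint3 i)
          (fun x _ => hh.differentiable one_ne_zero x)
          (fun x _ => (hG i).differentiable one_ne_zero x), neg_neg]
    _ = -∫ x, ∑ i, h x * fderiv ℝ (fun x => inner ℝ (b i) (F x)) x (b i) ∂μ := by
        rw [integral_finsetSum _ fun i _ => hint2 i]
    _ = 0 := by
        have : ∀ x, ∑ i, h x * fderiv ℝ (fun x => inner ℝ (b i) (F x)) x (b i) = 0 := fun x => by
          have := hdiv x
          rw [LinearMap.trace_eq_sum_inner _ b] at this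
          simp only [ContinuousLinearMap.coe_coe] at this
          simp_rw [hGd, ← Finset.mul_sum, this, mul_zero]
        simp [this]

/-- The integral of a test function composed with the flow of a divergence-free vector field is
stationary at time zero. -/
lemma hasDerivAt_integral_comp_flow_zero {F : E → E} (hF : ContDiff ℝ 1 F)
    (hdiv : ∀ x, LinearMap.trace ℝ E (fderiv ℝ F x).toLinearMap = 0) {φ : ℝ → E → E}
    (hφ0 : ∀ x, φ 0 x = x) (hφ' : ∀ t x, HasDerivAt (fun τ => φ τ x) (F (φ t x)) t)
    (hφc : ∀ t, Continuous (φ t)) {h : E → ℝ} (hh : ContDiff ℝ 1 h) (hc : HasCompactSupport h) :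
    HasDerivAt (fun s => ∫ x, h (φ s x) ∂μ) 0 0 := by
  have hcont : Continuous fun x => fderiv ℝ h x (F x) :=
    (hh.continuous_fderiv one_ne_zero).clm_apply hF.continuous
  obtain ⟨R, hR⟩ := hc.isCompact.isBounded.exists_norm_le
  obtain ⟨ε, hε, hεR⟩ := exists_norm_le_of_flow_norm_le hF hφ0 hφ' R
  have hsupp : ∀ y, R < ‖y‖ → fderiv ℝ h y (F y) = 0 := fun y hy => by
    have : fderiv ℝ h y = 0 := image_eq_zero_of_notMem_tsupport fun hy' =>
      (hR y (tsupport_fderiv_subset ℝ hy')).not_gt hy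
    simp [this]
  have hcs : HasCompactSupport fun x => fderiv ℝ h x (F x) :=
    HasCompactSupport.intro (isCompact_closedBall 0 R) fun y hy =>
      hsupp y (by simpa using hy)
  obtain ⟨C, hC⟩ := hcs.exists_bound_of_continuous hcont
  have hC0 : 0 ≤ C := (norm_nonneg _).trans (hC 0)
  have key := (hasDerivAt_integral_of_dominated_loc_of_deriv_le (μ := μ) (x₀ := (0 : ℝ))
    (F := fun s x => h (φ s x)) (F' := fun s x => fderiv ℝ h (φ s x) (F (φ s x)))
    (bound := (Metric.closedBall (0 : E) (R + 1)).indicator fun _ => C)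
    (Metric.ball_mem_nhds 0 hε)
    (Eventually.of_forall fun s => (hh.continuous.comp (hφc s)).aestronglyMeasurable)
    (by simpa only [hφ0] using hh.continuous.integrable_of_hasCompactSupport hc)
    (hcont.comp (hφc 0)).aestronglyMeasurable
    (Eventually.of_forall fun x s hs => by
      by_cases hx : x ∈ Metric.closedBall (0 : E) (R + 1)
      · simpa only [indicator_of_mem hx] using hC (φ s x)
      · rw [indicator_of_notMem hx, hsupp _ (not_le.1 fun hle => hx ?_), norm_zero]
        simpa using hεR s x (by simpa using hs) hle)
    ((integrable_indicator_iff Metric.isClosed_closedBall.measurableSet).2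
      (integrableOn_const (isCompact_closedBall _ _).measure_lt_top.ne))
    (Eventually.of_forall fun x s _ =>
      ((hh.differentiable one_ne_zero (φ s x)).hasFDerivAt).comp_hasDerivAt s (hφ' s x))).2
  simp only [hφ0] at key
  rwa [integral_fderiv_apply_eq_zero_of_trace_eq_zero hF hdiv hh hc] at key

/-- The flow of a divergence-free vector field preserves integrals of test functions. -/
lemma integral_comp_flow {F : E → E} (hF : ContDiff ℝ 1 F)
    (hdiv : ∀ x, LinearMap.trace ℝ E (fderiv ℝ F x).toLinearMap = 0) {φ : ℝ → E → E}
    (hφ0 : ∀ x, φ 0 x = x) (hφ' : ∀ t x, HasDerivAt (fun τ => φ τ x) (F (φ t x)) t)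
    (hφ : ∀ t, ContDiff ℝ 1 (φ t)) {h : E → ℝ} (hh : ContDiff ℝ 1 h) (hc : HasCompactSupport h)
    (t : ℝ) : ∫ x, h (φ t x) ∂μ = ∫ x, h x ∂μ := by
  have hderiv : ∀ t, HasDerivAt (fun s => ∫ x, h (φ s x) ∂μ) 0 t := fun t => by
    have hct : HasCompactSupport fun x => h (φ t x) := by
      refine HasCompactSupport.intro (hc.isCompact.image (hφ (-t)).continuous) fun x hx => ?_
      refine image_eq_zero_of_notMem_tsupport fun hx' => hx ⟨_, hx', ?_⟩
      rw [← flow_add hF hφ0 hφ', neg_add_cancel, hφ0]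
    have : HasDerivAt (fun s => ∫ x, h (φ t (φ s x)) ∂μ) 0 (t - t) := by
      rw [sub_self]
      exact hasDerivAt_integral_comp_flow_zero hF hdiv hφ0 hφ'
        (fun t => (hφ t).continuous) (hh.comp (hφ t)) hct
    have := this.comp_sub_const t t
    simpa only [← flow_add hF hφ0 hφ', add_sub_cancel] using this
  have := is_const_of_deriv_eq_zero (fun t => (hderiv t).differentiableAt)
    (fun t => (hderiv t).deriv) t 0
  simpa only [hφ0] using this

/-- Locally finite measures which integrate `C¹` test functions equally are equal. -/
lemma measure_ext_of_integral_contDiff_eq {μ ν : Measure E}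
    [IsFiniteMeasureOnCompacts μ] [IsFiniteMeasureOnCompacts ν]
    (H : ∀ h : E → ℝ, ContDiff ℝ 1 h → HasCompactSupport h → ∫ x, h x ∂μ = ∫ x, h x ∂ν) :
    μ = ν := by
  have hbd : ∀ (ρ : Measure E) [IsFiniteMeasureOnCompacts ρ] {U : Set E},
      Bornology.IsBounded U → ρ U ≠ ⊤ := fun ρ _ U hU => hU.measure_lt_top.ne
  have hlim : ∀ (ρ : Measure E) [IsFiniteMeasureOnCompacts ρ] (U : Set E) (f : E → ℝ), IsOpen U →
      Bornology.IsBounded U → f.support = U → Continuous f → (∀ x, 0 ≤ f x) →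
      Tendsto (fun n : ℕ => ∫ x, Real.smoothTransition (n * f x) ∂ρ) atTop (𝓝 (ρ.real U)) := by
    intro ρ _ U f hU hUb hfU hfc hf0
    rw [← integral_indicator_one hU.measurableSet]
    refine tendsto_integral_of_dominated_convergence (U.indicator 1)
      (fun n => (Real.smoothTransition.continuous.comp
        (continuous_const.mul hfc)).aestronglyMeasurable)
      ((integrable_indicator_iff hU.measurableSet).2 (integrableOn_const (hbd ρ hUb)))
      (fun n => Eventually.of_forall fun x => ?_) (Eventually.of_forall fun x => ?_)
    · by_cases hx : x ∈ U
      · simpa [hx, abs_of_nonneg (Real.smoothTransition.nonneg _)] using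
          Real.smoothTransition.le_one _
      · have : f x = 0 := by simpa [← hfU] using hx
        simp [hx, this]
    · by_cases hx : x ∈ U
      · have hpos : 0 < f x := (hf0 x).lt_of_ne' (by simpa [← hfU] using hx)
        have : Tendsto (fun n : ℕ => n * f x) atTop atTop :=
          tendsto_natCast_atTop_atTop.atTop_mul_const hpos
        refine tendsto_const_nhds.congr' ((this.eventually_ge_atTop 1).mono fun n hn => ?_)
        simp [hx, Real.smoothTransition.one_of_one_le hn]
      · have : f x = 0 := by simpa [← hfU] using hx
        simp [hx, this]
  have hball : ∀ n : ℕ, Metric.ball (0 : E) n ∈ {U : Set E | IsOpen U ∧ Bornology.IsBounded U} :=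
    fun n => ⟨Metric.isOpen_ball, Metric.isBounded_ball⟩
  refine Measure.ext_of_generateFrom_of_iUnion {U : Set E | IsOpen U ∧ Bornology.IsBounded U}
    (fun n => Metric.ball 0 n) ?_ ?_ (Metric.iUnion_ball_nat 0) hball
    (fun n => hbd μ (hball n).2) ?_
  · rw [BorelSpace.measurable_eq (α := E)]
    refine (TopologicalSpace.isTopologicalBasis_of_isOpen_of_nhds (fun U hU => hU.1)
      fun x V hx hV => ?_).borel_eq_generateFrom
    exact ⟨V ∩ Metric.ball x 1, ⟨hV.inter Metric.isOpen_ball,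
      Metric.isBounded_ball.subset inter_subset_right⟩, ⟨hx, by simp⟩, inter_subset_left⟩
  · exact fun U hU V hV _ => ⟨hU.1.inter hV.1, hU.2.subset inter_subset_left⟩
  · rintro U ⟨hU, hUb⟩
    obtain ⟨f, hfU, hf, hf01⟩ := hU.exists_contDiff_support_eq (n := 1)
    have hf0 : ∀ x, 0 ≤ f x := fun x => (hf01 (mem_range_self x)).1
    have heq : ∀ n : ℕ, ∫ x, Real.smoothTransition (n * f x) ∂μ
        = ∫ x, Real.smoothTransition (n * f x) ∂ν := fun n => by
      refine H _ ((Real.smoothTransition.contDiff (n := 1)).comp (contDiff_const.mul hf)) ?_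
      refine HasCompactSupport.intro hUb.isCompact_closure fun x hx => ?_
      have : f x = 0 := by simpa [← hfU] using fun h => hx (subset_closure h)
      simp [this]
    have h1 := hlim μ U f hU hUb hfU hf.continuous hf0
    simp_rw [heq] at h1
    have := tendsto_nhds_unique h1 (hlim ν U f hU hUb hfU hf.continuous hf0)
    exact (measureReal_eq_measureReal_iff (hbd μ hUb) (hbd ν hUb)).1 this

/-- **Liouville's theorem**: the flow of a divergence-free vector field preserves volume. -/
lemma measurePreserving_flow {F : E → E} (hF : ContDiff ℝ 1 F)
    (hdiv : ∀ x, LinearMap.trace ℝ E (fderiv ℝ F x).toLinearMap = 0) {φ : ℝ → E → E}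
    (hφ0 : ∀ x, φ 0 x = x) (hφ' : ∀ t x, HasDerivAt (fun τ => φ τ x) (F (φ t x)) t)
    (hφ : ∀ t, ContDiff ℝ 1 (φ t)) (t : ℝ) : MeasurePreserving (φ t) μ μ := by
  have hm : Measurable (φ t) := (hφ t).continuous.measurable
  have : IsFiniteMeasureOnCompacts (μ.map (φ t)) := ⟨fun K hK => by
    rw [Measure.map_apply hm hK.measurableSet]
    have hsub : φ t ⁻¹' K ⊆ φ (-t) '' K := fun x hx => ⟨φ t x, hx, by
      rw [← flow_add hF hφ0 hφ', neg_add_cancel, hφ0]⟩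
    exact (measure_mono hsub).trans_lt (hK.image (hφ (-t)).continuous).measure_lt_top⟩
  refine ⟨hm, measure_ext_of_integral_contDiff_eq fun h hh hc => ?_⟩
  rw [integral_map hm.aemeasurable hh.continuous.aestronglyMeasurable]
  exact integral_comp_flow hF hdiv hφ0 hφ' hφ hh hc t

end Liouville


/-- Liouville's theorem: if `F : ℝ^d → ℝ^d` is a `C¹` divergence-free vector field and
`φ(t,·)` is a flow of `F` (`φ(0,x) = x`, `∂ₜφ(t,x) = F(φ(t,x))`) such that each `φ(t,·)` is a
`C¹` diffeomorphism of `ℝ^d`, then each `φ(t,·)` preserves the Lebesgue measure. -/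
theorem stmt4 (d : ℕ) (F : EuclideanSpace ℝ (Fin d) → EuclideanSpace ℝ (Fin d))
    (hF : ContDiff ℝ 1 F)
    (hdiv : ∀ x, LinearMap.trace ℝ (EuclideanSpace ℝ (Fin d)) ((fderiv ℝ F x).toLinearMap) = 0)
    (φ : ℝ → EuclideanSpace ℝ (Fin d) → EuclideanSpace ℝ (Fin d))
    (hφ0 : ∀ x, φ 0 x = x)
    (hφ' : ∀ t x, HasDerivAt (fun τ => φ τ x) (F (φ t x)) t)
    (hφsmooth : ∀ t, ContDiff ℝ 1 (φ t))
    (hφbij : ∀ t, Function.Bijective (φ t))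
    (hφinvsmooth : ∀ t, ContDiff ℝ 1 (Function.invFun (φ t))) :
    ∀ t : ℝ, ∀ A : Set (EuclideanSpace ℝ (Fin d)), MeasurableSet A →
      volume (φ t ⁻¹' A) = volume A := by
  exact fun t A hA =>
    (measurePreserving_flow hF hdiv hφ0 hφ' hφsmooth t).measure_preimage hA.nullMeasurableSet
end

section
/- Let d ∈ ℕ, let W be a symmetric positive definite real d×d matrix, and let F : ℝ^d → ℝ^d be continuously differentiable with ⟨W x, F(x)⟩ = 0 for all x ∈ ℝ^d. Then for every x₀ ∈ ℝ^d there exists a unique global solution x : ℝ → ℝ^d of the ODE x'(t) = F(x(t)) with x(0) = x₀, and the energy is conserved: ⟨x(t), W x(t)⟩ = ⟨x₀, W x₀⟩ for all t ∈ ℝ. -/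
open Matrix

/-- A bounded Lipschitz vector field on a Banach space has global integral curves. -/
theorem exists_forall_hasDerivAt_of_lipschitzWith_of_norm_le {E : Type*} [NormedAddCommGroup E]
    [NormedSpace ℝ E] [CompleteSpace E] {G : E → E} {K L : NNReal} (hG : LipschitzWith K G)
    (hL : ∀ x, ‖G x‖ ≤ L) (x₀ : E) :
    ∃ x : ℝ → E, x 0 = x₀ ∧ ∀ t, HasDerivAt x (G (x t)) t := by
  have exists_on (T : ℝ) : ∃ α : ℝ → E, α 0 = x₀ ∧
      ∀ t ∈ Set.Ioo (-T) T, HasDerivAt α (G (α t)) t := by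
    rcases le_or_gt T 0 with hT | hT
    · exact ⟨fun _ ↦ x₀, rfl, fun t ht ↦ by linarith [ht.1, ht.2]⟩
    have h0 : (0 : ℝ) ∈ Set.Icc (-T) T := ⟨by linarith, hT.le⟩
    have hPL : IsPicardLindelof (fun _ ↦ G) (⟨0, h0⟩ : Set.Icc (-T) T) x₀
        (L * T.toNNReal) 0 L K :=
      .of_time_independent (fun x _ ↦ hL x) hG.lipschitzOnWith (by simp [hT.le])
    obtain ⟨α, hα₀, hα⟩ := hPL.exists_eq_forall_mem_Icc_hasDerivWithinAt₀
    exact ⟨α, hα₀, fun t ht ↦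
      (hα t (Set.Ioo_subset_Icc_self ht)).hasDerivAt (Icc_mem_nhds ht.1 ht.2)⟩
  choose α hα₀ hα using exists_on
  have hα_eq {S T : ℝ} (hS : 0 < S) (hST : S ≤ T) : Set.EqOn (α S) (α T) (Set.Ioo (-S) S) :=
    ODE_solution_unique_of_mem_Ioo (v := fun _ ↦ G) (s := fun _ ↦ Set.univ) (t₀ := 0)
      (fun _ _ ↦ hG.lipschitzOnWith) ⟨by linarith, hS⟩ (fun t ht ↦ ⟨hα S t ht, trivial⟩)
      (fun t ht ↦ ⟨hα T t ⟨by linarith [ht.1], by linarith [ht.2]⟩, trivial⟩)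
      ((hα₀ S).trans (hα₀ T).symm)
  have hx {T s : ℝ} (hs : |s| + 1 ≤ T) : α (|s| + 1) s = α T s :=
    hα_eq (by positivity) hs (abs_lt.mp (lt_add_one _))
  refine ⟨fun t ↦ α (|t| + 1) t, hα₀ _, fun t ↦ ?_⟩
  have hev : (fun s ↦ α (|s| + 1) s) =ᶠ[nhds t] α (|t| + 2) := by
    filter_upwards [continuous_abs.continuousAt.eventually_lt_const (lt_add_one |t|)] with s hs
    exact hx (by linarith)
  have h := (hα (|t| + 2) t (abs_lt.mp (by linarith))).congr_of_eventuallyEq hev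
  rwa [← hx (by linarith : |t| + 1 ≤ |t| + 2)] at h

theorem Matrix.PosDef.exists_pos_forall_mul_norm_sq_le {n : Type*} [Fintype n]
    {W : Matrix n n ℝ} (hW : W.PosDef) :
    ∃ c > 0, ∀ x : n → ℝ, c * ‖x‖ ^ 2 ≤ x ⬝ᵥ W *ᵥ x := by
  obtain ⟨c, hc, h⟩ := (isCompact_sphere (0 : n → ℝ) 1).exists_forall_le'
    (f := fun x ↦ x ⬝ᵥ W *ᵥ x) (by fun_prop) (a := 0) fun x hx ↦ by
      simpa using hW.dotProduct_mulVec_pos (ne_zero_of_mem_unit_sphere ⟨x, hx⟩)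
  refine ⟨c, hc, fun x ↦ ?_⟩
  rcases eq_or_ne x 0 with rfl | hx
  · simp
  have hx' : ‖x‖ ≠ 0 := norm_ne_zero_iff.mpr hx
  have h1 := h (‖x‖⁻¹ • x) (by simp [norm_smul, hx'])
  simp only [mulVec_smul, dotProduct_smul, smul_dotProduct, smul_eq_mul] at h1
  calc c * ‖x‖ ^ 2 ≤ (‖x‖⁻¹ * (‖x‖⁻¹ * (x ⬝ᵥ W *ᵥ x))) * ‖x‖ ^ 2 := by gcongr
    _ = x ⬝ᵥ W *ᵥ x := by field_simp

theorem HasDerivAt.dotProduct {n : Type*} [Fintype n] {x y : ℝ → n → ℝ} {x' y' : n → ℝ} {t : ℝ}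
    (hx : HasDerivAt x x' t) (hy : HasDerivAt y y' t) :
    HasDerivAt (fun s ↦ x s ⬝ᵥ y s) (x' ⬝ᵥ y t + x t ⬝ᵥ y') t := by
  simp only [_root_.dotProduct, ← Finset.sum_add_distrib]
  exact HasDerivAt.fun_sum fun i _ ↦ (hasDerivAt_pi.mp hx i).mul (hasDerivAt_pi.mp hy i)

theorem HasDerivAt.const_mulVec {m n : Type*} [Fintype m] [Fintype n] (W : Matrix m n ℝ)
    {x : ℝ → n → ℝ} {x' : n → ℝ} {t : ℝ} (hx : HasDerivAt x x' t) :
    HasDerivAt (fun s ↦ W *ᵥ x s) (W *ᵥ x') t :=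
  W.mulVecLin.toContinuousLinearMap.hasFDerivAt.comp_hasDerivAt t hx

/-- The quadratic form of a symmetric matrix is constant along the integral curves of a vector
field orthogonal to its gradient. -/
theorem dotProduct_mulVec_eq_of_hasDerivAt {n : Type*} [Fintype n] {W : Matrix n n ℝ}
    (hW : W.IsSymm) {G : (n → ℝ) → n → ℝ} (hG : ∀ x, W *ᵥ x ⬝ᵥ G x = 0) {x : ℝ → n → ℝ}
    (hx : ∀ t, HasDerivAt x (G (x t)) t) (s t : ℝ) :
    x s ⬝ᵥ W *ᵥ x s = x t ⬝ᵥ W *ᵥ x t := by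
  have hderiv (t : ℝ) : HasDerivAt (fun t ↦ x t ⬝ᵥ W *ᵥ x t) 0 t := by
    convert (hx t).dotProduct ((hx t).const_mulVec W) using 1
    rw [dotProduct_mulVec (x t), ← mulVec_transpose, hW.eq, hG, dotProduct_comm, hG, add_zero]
  exact is_const_of_deriv_eq_zero (fun t ↦ (hderiv t).differentiableAt)
    (fun t ↦ (hderiv t).deriv) s t

/-- If `W` is a symmetric positive definite `d×d` matrix and `F : ℝ^d → ℝ^d` is `C¹` with
`⟨Wx, F(x)⟩ = 0` for all `x`, then for every initial datum `x₀` there is a unique global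
solution of `x' = F(x)`, `x(0) = x₀`, and the energy `⟨x(t), W x(t)⟩` is conserved. -/
theorem stmt6 (d : ℕ) (W : Matrix (Fin d) (Fin d) ℝ)
    (hWsymm : W.IsSymm) (hWpos : W.PosDef)
    (F : (Fin d → ℝ) → (Fin d → ℝ)) (hF : ContDiff ℝ 1 F)
    (hFort : ∀ x : Fin d → ℝ, W.mulVec x ⬝ᵥ F x = 0) :
    ∀ x₀ : Fin d → ℝ,
      ∃ x : ℝ → (Fin d → ℝ),
        (x 0 = x₀ ∧ ∀ t : ℝ, HasDerivAt x (F (x t)) t) ∧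
        (∀ y : ℝ → (Fin d → ℝ),
          (y 0 = x₀ ∧ ∀ t : ℝ, HasDerivAt y (F (y t)) t) → y = x) ∧
        (∀ t : ℝ, x t ⬝ᵥ W.mulVec (x t) = x₀ ⬝ᵥ W.mulVec x₀) := by
  intro x₀
  obtain ⟨c, hc, hcW⟩ := hWpos.exists_pos_forall_mul_norm_sq_le
  -- A closed ball containing the energy level set of `x₀`.
  obtain ⟨R, hR, hRW⟩ : ∃ R > 0, ∀ x : Fin d → ℝ,
      x ⬝ᵥ W *ᵥ x = x₀ ⬝ᵥ W *ᵥ x₀ → x ∈ Metric.closedBall 0 R := by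
    refine ⟨√((x₀ ⬝ᵥ W *ᵥ x₀) / c) + 1, by positivity, fun x hx ↦ ?_⟩
    have h : ‖x‖ ≤ √((x₀ ⬝ᵥ W *ᵥ x₀) / c) := by
      apply Real.le_sqrt_of_sq_le
      rw [le_div_iff₀ hc, mul_comm, ← hx]
      exact hcW x
    rw [mem_closedBall_zero_iff]
    linarith
  let χ : ContDiffBump (0 : Fin d → ℝ) := ⟨R, R + 1, hR, lt_add_one R⟩
  let G : (Fin d → ℝ) → Fin d → ℝ := fun x ↦ χ x • F x
  have hG : ContDiff ℝ 1 G := χ.contDiff.smul hF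
  have hGsupp : HasCompactSupport G := χ.hasCompactSupport.smul_right
  have hGF {x : Fin d → ℝ} (hx : x ⬝ᵥ W *ᵥ x = x₀ ⬝ᵥ W *ᵥ x₀) : G x = F x := by
    simp only [G, χ.one_of_mem_closedBall (hRW x hx), one_smul]
  obtain ⟨K, hK⟩ := hG.lipschitzWith_of_hasCompactSupport hGsupp one_ne_zero
  obtain ⟨L, hL⟩ := hGsupp.exists_bound_of_continuous hG.continuous
  obtain ⟨x, hx₀, hx⟩ := exists_forall_hasDerivAt_of_lipschitzWith_of_norm_le hK
    (fun x ↦ (hL x).trans L.le_coe_toNNReal) x₀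
  have hE (t : ℝ) : x t ⬝ᵥ W *ᵥ x t = x₀ ⬝ᵥ W *ᵥ x₀ := by
    simpa only [hx₀] using dotProduct_mulVec_eq_of_hasDerivAt hWsymm
      (fun x ↦ by simp only [G, dotProduct_smul, hFort, smul_zero]) hx t 0
  refine ⟨x, ⟨hx₀, fun t ↦ hGF (hE t) ▸ hx t⟩, fun y ⟨hy₀, hy⟩ ↦ ?_, hE⟩
  have hEy (t : ℝ) : y t ⬝ᵥ W *ᵥ y t = x₀ ⬝ᵥ W *ᵥ x₀ := by
    simpa only [hy₀] using dotProduct_mulVec_eq_of_hasDerivAt hWsymm hFort hy t 0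
  exact ODE_solution_unique_univ (v := fun _ ↦ G) (s := fun _ ↦ Set.univ) (t₀ := 0)
    (fun _ ↦ hK.lipschitzOnWith) (fun t ↦ ⟨(hGF (hEy t)).symm ▸ hy t, trivial⟩)
    (fun t ↦ ⟨hx t, trivial⟩) (hy₀.trans hx₀.symm)
end

section
/- Let s ∈ [0, 1/2), let g : ℤ × ℤ → ℂ satisfy ‖g‖ := sup_{n∈ℤ} ∑_{m∈ℤ} |g(n,m)| < ∞, and let u, v ∈ ℓ²(ℤ, ℂ). Then for each n ∈ ℤ the double sum c_n = ∑_{m∈ℤ} g(n,m) ∑_{l∈ℤ} u_{m−l} v_l converges absolutely with |c_n| ≤ ‖g‖ ‖u‖₂ ‖v‖₂, and moreover ∑_{n∈ℤ} ( n² / (1+n²)^{2−s} ) |c_n|² ≤ C_s ‖g‖² ‖u‖₂² ‖v‖₂², where C_s = ∑_{k∈ℤ} k²/(1+k²)^{2−s} < ∞. (This is the Fourier-coefficient form of the bilinear estimate ‖(1−∂ₓ²)^{−1}∂ₓ (g(uv))‖_{H^s} ≤ C ‖g‖ ‖u‖_{L²} ‖v‖_{L²} for periodic functions.) -/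
/-- Cauchy–Schwarz for the absolute convolution of two square-summable sequences. -/
lemma summable_and_tsum_norm_conv_le {u v : ℤ → ℂ}
    (hu : Summable fun n : ℤ => ‖u n‖ ^ 2) (hv : Summable fun n : ℤ => ‖v n‖ ^ 2) (m : ℤ) :
    (Summable fun l : ℤ => ‖u (m - l)‖ * ‖v l‖) ∧
      ∑' l : ℤ, ‖u (m - l)‖ * ‖v l‖
        ≤ Real.sqrt (∑' k : ℤ, ‖u k‖ ^ 2) * Real.sqrt (∑' k : ℤ, ‖v k‖ ^ 2) := by
  have hu' : Summable fun l : ℤ => ‖u (m - l)‖ ^ 2 :=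
    (Equiv.subLeft m).summable_iff.2 hu
  have key := Real.summable_and_inner_le_Lp_mul_Lq_tsum_of_nonneg Real.HolderConjugate.two_two
    (f := fun l : ℤ => ‖u (m - l)‖) (g := fun l : ℤ => ‖v l‖)
    (fun _ => norm_nonneg _) (fun _ => norm_nonneg _)
    (by simpa only [Real.rpow_two] using hu') (by simpa only [Real.rpow_two] using hv)
  have hshift : ∑' l : ℤ, ‖u (m - l)‖ ^ 2 = ∑' k : ℤ, ‖u k‖ ^ 2 :=
    (Equiv.subLeft m).tsum_eq fun k => ‖u k‖ ^ 2
  simpa only [Real.rpow_two, ← Real.sqrt_eq_rpow, hshift] using key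

lemma norm_conv_le {u v : ℤ → ℂ}
    (hu : Summable fun n : ℤ => ‖u n‖ ^ 2) (hv : Summable fun n : ℤ => ‖v n‖ ^ 2) (m : ℤ) :
    ‖∑' l : ℤ, u (m - l) * v l‖
      ≤ Real.sqrt (∑' k : ℤ, ‖u k‖ ^ 2) * Real.sqrt (∑' k : ℤ, ‖v k‖ ^ 2) := by
  obtain ⟨h1, h2⟩ := summable_and_tsum_norm_conv_le hu hv m
  simp only [← norm_mul] at h1 h2
  exact (norm_tsum_le_tsum_norm h1).trans h2

lemma norm_tsum_mul_le_of_norm_le {ι : Type*} {a b : ι → ℂ} {C : ℝ}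
    (ha : Summable fun i => ‖a i‖) (hb : ∀ i, ‖b i‖ ≤ C) :
    ‖∑' i, a i * b i‖ ≤ (∑' i, ‖a i‖) * C := by
  rw [← tsum_mul_right]
  refine tsum_of_norm_bounded (ha.mul_right C).hasSum fun i => ?_
  rw [norm_mul]
  exact mul_le_mul_of_nonneg_left (hb i) (norm_nonneg _)

lemma summable_int_sq_div_one_add_sq_rpow {s : ℝ} (hs : s < 1 / 2) :
    Summable fun k : ℤ => (k : ℝ) ^ 2 / (1 + (k : ℝ) ^ 2) ^ (2 - s) := by
  refine Summable.of_nonneg_of_le (fun k => by positivity) (fun k => ?_)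
    (Real.summable_abs_int_rpow (b := 2 - 2 * s) (by linarith))
  rcases eq_or_ne k 0 with rfl | hk
  · simp only [Int.cast_zero, ne_eq, OfNat.ofNat_ne_zero, not_false_eq_true, zero_pow, zero_div]
    positivity
  have hk' : 0 < |(k : ℝ)| := abs_pos.2 (Int.cast_ne_zero.2 hk)
  calc (k : ℝ) ^ 2 / (1 + (k : ℝ) ^ 2) ^ (2 - s)
      ≤ (k : ℝ) ^ 2 / ((k : ℝ) ^ 2) ^ (2 - s) := by
        have : 0 < (k : ℝ) ^ 2 := by positivity
        gcongr
        · linarith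
        · linarith
    _ = |(k : ℝ)| ^ (-(2 - 2 * s)) := by
        rw [← sq_abs, ← Real.rpow_two, ← Real.rpow_mul hk'.le, ← Real.rpow_sub hk']
        congr 1
        ring


/-- Bilinear estimate, Fourier-coefficient form: with `‖g‖ := sup_n ∑_m |g(n,m)| ≤ G` and
`u, v ∈ ℓ²(ℤ,ℂ)`, the coefficients `c_n = ∑_m g(n,m) (u⋆v)_m` converge absolutely with
`|c_n| ≤ G ‖u‖₂ ‖v‖₂` and satisfy
`∑_n (n²/(1+n²)^{2-s}) |c_n|² ≤ C_s G² ‖u‖₂² ‖v‖₂²` where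
`C_s = ∑_k k²/(1+k²)^{2-s} < ∞`. -/
theorem stmt7 (s : ℝ) (hs0 : 0 ≤ s) (hs : s < 1 / 2)
    (g : ℤ → ℤ → ℂ) (G : ℝ)
    (hgsum : ∀ n : ℤ, Summable fun m : ℤ => ‖g n m‖)
    (hgG : ∀ n : ℤ, (∑' m : ℤ, ‖g n m‖) ≤ G)
    (u v : ℤ → ℂ)
    (hu : Summable fun n : ℤ => ‖u n‖ ^ 2) (hv : Summable fun n : ℤ => ‖v n‖ ^ 2) :
    (∀ n : ℤ, Summable fun p : ℤ × ℤ => ‖g n p.1‖ * (‖u (p.1 - p.2)‖ * ‖v p.2‖)) ∧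
    (∀ n : ℤ, ‖∑' m : ℤ, g n m * ∑' l : ℤ, u (m - l) * v l‖
        ≤ G * Real.sqrt (∑' k : ℤ, ‖u k‖ ^ 2) * Real.sqrt (∑' k : ℤ, ‖v k‖ ^ 2)) ∧
    Summable (fun k : ℤ => (k : ℝ) ^ 2 / (1 + (k : ℝ) ^ 2) ^ (2 - s)) ∧
    Summable (fun n : ℤ => (n : ℝ) ^ 2 / (1 + (n : ℝ) ^ 2) ^ (2 - s) *
        ‖∑' m : ℤ, g n m * ∑' l : ℤ, u (m - l) * v l‖ ^ 2) ∧
    (∑' n : ℤ, (n : ℝ) ^ 2 / (1 + (n : ℝ) ^ 2) ^ (2 - s) *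
        ‖∑' m : ℤ, g n m * ∑' l : ℤ, u (m - l) * v l‖ ^ 2)
      ≤ (∑' k : ℤ, (k : ℝ) ^ 2 / (1 + (k : ℝ) ^ 2) ^ (2 - s)) * G ^ 2 *
          (∑' k : ℤ, ‖u k‖ ^ 2) * (∑' k : ℤ, ‖v k‖ ^ 2) := by
  have hc : ∀ n : ℤ, ‖∑' m : ℤ, g n m * ∑' l : ℤ, u (m - l) * v l‖
      ≤ G * Real.sqrt (∑' k : ℤ, ‖u k‖ ^ 2) * Real.sqrt (∑' k : ℤ, ‖v k‖ ^ 2) := fun n => by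
    rw [mul_assoc]
    exact (norm_tsum_mul_le_of_norm_le (hgsum n) (norm_conv_le hu hv)).trans
      (mul_le_mul_of_nonneg_right (hgG n) (by positivity))
  have hw := summable_int_sq_div_one_add_sq_rpow hs
  have hterm : ∀ n : ℤ, (n : ℝ) ^ 2 / (1 + (n : ℝ) ^ 2) ^ (2 - s) *
        ‖∑' m : ℤ, g n m * ∑' l : ℤ, u (m - l) * v l‖ ^ 2
      ≤ (n : ℝ) ^ 2 / (1 + (n : ℝ) ^ 2) ^ (2 - s) *
        (G ^ 2 * (∑' k : ℤ, ‖u k‖ ^ 2) * (∑' k : ℤ, ‖v k‖ ^ 2)) := fun n => by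
    refine mul_le_mul_of_nonneg_left ?_ (by positivity)
    refine (pow_le_pow_left₀ (norm_nonneg _) (hc n) 2).trans_eq ?_
    rw [mul_pow, mul_pow, Real.sq_sqrt (tsum_nonneg fun _ => by positivity),
      Real.sq_sqrt (tsum_nonneg fun _ => by positivity)]
  have hsum := Summable.of_nonneg_of_le (fun n : ℤ => by positivity) hterm (hw.mul_right _)
  refine ⟨fun n => ?_, hc, hw, hsum, ?_⟩
  · have hnonneg : 0 ≤ fun p : ℤ × ℤ => ‖g n p.1‖ * (‖u (p.1 - p.2)‖ * ‖v p.2‖) :=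
      fun p => mul_nonneg (norm_nonneg _) (mul_nonneg (norm_nonneg _) (norm_nonneg _))
    rw [summable_prod_of_nonneg hnonneg]
    refine ⟨fun m => (summable_and_tsum_norm_conv_le hu hv m).1.mul_left ‖g n m‖, ?_⟩
    simp only [tsum_mul_left]
    exact Summable.of_nonneg_of_le
      (fun m => mul_nonneg (norm_nonneg _) (tsum_nonneg fun _ => by positivity))
      (fun m => mul_le_mul_of_nonneg_left (summable_and_tsum_norm_conv_le hu hv m).2
        (norm_nonneg _))
      ((hgsum n).mul_right _)
  · refine (Summable.tsum_le_tsum hterm hsum (hw.mul_right _)).trans_eq ?_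
    rw [tsum_mul_right]
    ring
end

section
/- Let s ∈ [0, 1/2) and s₁ > 0. There exists a constant C (depending only on s and s₁) such that for every g : ℤ × ℤ → ℂ with ‖g‖ := sup_{n} ∑_{m} |g(n,m)| < ∞, every N ≥ 1, and all sequences u, v : ℤ → ℂ with ‖u‖_{H^{s₁}}² := ∑_{n}(1+n²)^{s₁}|u_n|² < ∞ and ‖v‖_{H^{s₁}}² := ∑_{n}(1+n²)^{s₁}|v_n|² < ∞, the coefficients c_n = ∑_{|m|>N} g(n,m) (u⋆v)_m satisfy ∑_{n∈ℤ} ( n²/(1+n²)^{2−s} ) |c_n|² ≤ C N^{−2s₁} ‖g‖² ‖u‖_{H^{s₁}}² ‖v‖_{H^{s₁}}². (This is the Fourier-coefficient form of the estimate ‖(1−∂ₓ²)^{−1}∂ₓ (g((1−Π_N)(uv)))‖_{H^s} ≤ C N^{−s₁} ‖g‖ ‖u‖_{H^{s₁}} ‖v‖_{H^{s₁}}.) -/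
theorem summable_mul_and_tsum_mul_le_sqrt {ι : Type*} {a b : ι → ℝ} (ha : ∀ i, 0 ≤ a i)
    (hb : ∀ i, 0 ≤ b i) (hsa : Summable fun i => a i ^ 2) (hsb : Summable fun i => b i ^ 2) :
    (Summable fun i => a i * b i) ∧
      ∑' i, a i * b i ≤ √(∑' i, a i ^ 2) * √(∑' i, b i ^ 2) := by
  have h0 : ∀ i, 0 ≤ a i * b i := fun i => mul_nonneg (ha i) (hb i)
  have h : ∀ t : Finset ι, ∑ i ∈ t, a i * b i ≤ √(∑' i, a i ^ 2) * √(∑' i, b i ^ 2) := by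
    intro t
    refine (Real.sum_mul_le_sqrt_mul_sqrt t a b).trans ?_
    gcongr
    · exact hsa.sum_le_tsum t fun i _ => sq_nonneg _
    · exact hsb.sum_le_tsum t fun i _ => sq_nonneg _
  exact ⟨summable_of_sum_le h0 h, Real.tsum_le_of_sum_le h0 h⟩

theorem rpow_abs_add_le_weight_mul {r : ℝ} (hr : 0 ≤ r) (a b : ℝ) :
    |a + b| ^ r ≤ (1 + a ^ 2) ^ (r / 2) * (1 + b ^ 2) ^ (r / 2) := by
  rw [← Real.mul_rpow (by positivity) (by positivity)]
  have h : |a + b| ^ r = ((a + b) ^ 2) ^ (r / 2) := by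
    rw [← sq_abs, ← Real.rpow_natCast, ← Real.rpow_mul (abs_nonneg _)]
    congr 1
    push_cast
    ring
  rw [h]
  refine Real.rpow_le_rpow (by positivity) ?_ (by positivity)
  nlinarith [sq_nonneg (1 - a * b)]

theorem sq_weight_mul_norm (r : ℝ) (x : ℝ) (z : ℂ) :
    ((1 + x ^ 2) ^ (r / 2) * ‖z‖) ^ 2 = (1 + x ^ 2) ^ r * ‖z‖ ^ 2 := by
  rw [mul_pow, ← Real.rpow_natCast ((1 + x ^ 2) ^ (r / 2)), ← Real.rpow_mul (by positivity)]
  congr 2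
  push_cast
  ring

/-- A pointwise decay bound for the convolution of two `H^r` sequences. -/
theorem norm_convolution_le {r : ℝ} (hr : 0 ≤ r) {u v : ℤ → ℂ}
    (hu : Summable fun n : ℤ => (1 + (n : ℝ) ^ 2) ^ r * ‖u n‖ ^ 2)
    (hv : Summable fun n : ℤ => (1 + (n : ℝ) ^ 2) ^ r * ‖v n‖ ^ 2) (m : ℤ) :
    |(m : ℝ)| ^ r * ‖∑' l : ℤ, u (m - l) * v l‖ ≤
      √(∑' n : ℤ, (1 + (n : ℝ) ^ 2) ^ r * ‖u n‖ ^ 2) *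
        √(∑' n : ℤ, (1 + (n : ℝ) ^ 2) ^ r * ‖v n‖ ^ 2) := by
  let W : (ℤ → ℂ) → ℤ → ℝ := fun w n => (1 + (n : ℝ) ^ 2) ^ (r / 2) * ‖w n‖
  have hW : ∀ w n, 0 ≤ W w n := fun w n => by positivity
  have hsq : ∀ w n, W w n ^ 2 = (1 + (n : ℝ) ^ 2) ^ r * ‖w n‖ ^ 2 :=
    fun w n => sq_weight_mul_norm r n (w n)
  simp only [← hsq] at hu hv ⊢
  have hu' : Summable fun l => W u (m - l) ^ 2 := (Equiv.subLeft m).summable_iff.mpr hu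
  obtain ⟨hsum, hle⟩ := summable_mul_and_tsum_mul_le_sqrt (fun l => hW u (m - l)) (hW v) hu' hv
  have hshift : ∑' l, W u (m - l) ^ 2 = ∑' l, W u l ^ 2 :=
    (Equiv.subLeft m).tsum_eq fun l => W u l ^ 2
  rw [hshift] at hle
  refine le_trans ?_ hle
  have hpt : ∀ l, |(m : ℝ)| ^ r * ‖u (m - l) * v l‖ ≤ W u (m - l) * W v l := by
    intro l
    have h := rpow_abs_add_le_weight_mul hr ((m - l : ℤ) : ℝ) l
    rw [← Int.cast_add, sub_add_cancel] at h
    calc |(m : ℝ)| ^ r * ‖u (m - l) * v l‖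
        ≤ ((1 + ((m - l : ℤ) : ℝ) ^ 2) ^ (r / 2) * (1 + (l : ℝ) ^ 2) ^ (r / 2)) *
            ‖u (m - l) * v l‖ := by gcongr
      _ = W u (m - l) * W v l := by rw [norm_mul]; ring
  calc |(m : ℝ)| ^ r * ‖∑' l : ℤ, u (m - l) * v l‖
      = ‖∑' l : ℤ, ((|(m : ℝ)| ^ r : ℝ) : ℂ) * (u (m - l) * v l)‖ := by
        rw [tsum_mul_left, norm_mul, Complex.norm_real, Real.norm_of_nonneg (by positivity)]
    _ ≤ ∑' l, W u (m - l) * W v l := by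
        refine tsum_of_norm_bounded hsum.hasSum fun l => ?_
        rw [norm_mul, Complex.norm_real, Real.norm_of_nonneg (by positivity)]
        exact hpt l

theorem summable_sq_div_weight {s : ℝ} (hs : s < 1 / 2) :
    Summable fun n : ℤ => (n : ℝ) ^ 2 / (1 + (n : ℝ) ^ 2) ^ (2 - s) := by
  refine Summable.of_nonneg_of_le (fun n => by positivity) (fun n => ?_)
    (Real.summable_abs_int_rpow (b := 2 - 2 * s) (by linarith))
  rcases eq_or_ne n 0 with rfl | hn
  · simp only [Int.cast_zero, ne_eq, OfNat.ofNat_ne_zero, not_false_eq_true, zero_pow, zero_div]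
    positivity
  have hpos : 0 < |(n : ℝ)| := abs_pos.mpr (Int.cast_ne_zero.mpr hn)
  have hpow : |(n : ℝ)| ^ (4 - 2 * s) ≤ (1 + (n : ℝ) ^ 2) ^ (2 - s) := by
    have h : |(n : ℝ)| ^ (4 - 2 * s) = ((n : ℝ) ^ 2) ^ (2 - s) := by
      rw [← sq_abs, ← Real.rpow_natCast, ← Real.rpow_mul hpos.le]
      congr 1
      push_cast
      ring
    rw [h]
    exact Real.rpow_le_rpow (by positivity) (by linarith) (by linarith)
  rw [div_le_iff₀ (by positivity)]
  calc (n : ℝ) ^ 2 = |(n : ℝ)| ^ (-(2 - 2 * s)) * |(n : ℝ)| ^ (4 - 2 * s) := by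
        rw [← Real.rpow_add hpos, ← sq_abs, ← Real.rpow_natCast]
        congr 1
        push_cast
        ring
    _ ≤ _ := by gcongr

/-- Tail bilinear estimate, Fourier-coefficient form: for `s ∈ [0,1/2)` and `s₁ > 0` there is a
constant `C` such that for every `g` with `sup_n ∑_m |g(n,m)| ≤ G`, every `N ≥ 1` and all
`u, v` with finite `H^{s₁}` norms, the coefficients `c_n = ∑_{|m|>N} g(n,m) (u⋆v)_m` satisfy
`∑_n (n²/(1+n²)^{2-s}) |c_n|² ≤ C N^{-2s₁} G² ‖u‖_{H^{s₁}}² ‖v‖_{H^{s₁}}²`. -/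
theorem stmt8 (s : ℝ) (hs0 : 0 ≤ s) (hs : s < 1 / 2) (s₁ : ℝ) (hs₁ : 0 < s₁) :
    ∃ C : ℝ, 0 < C ∧
      ∀ (g : ℤ → ℤ → ℂ) (G : ℝ),
        (∀ n : ℤ, Summable fun m : ℤ => ‖g n m‖) →
        (∀ n : ℤ, (∑' m : ℤ, ‖g n m‖) ≤ G) →
        ∀ N : ℕ, 1 ≤ N →
        ∀ u v : ℤ → ℂ,
          Summable (fun n : ℤ => (1 + (n : ℝ) ^ 2) ^ s₁ * ‖u n‖ ^ 2) →
          Summable (fun n : ℤ => (1 + (n : ℝ) ^ 2) ^ s₁ * ‖v n‖ ^ 2) →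
          Summable (fun n : ℤ => (n : ℝ) ^ 2 / (1 + (n : ℝ) ^ 2) ^ (2 - s) *
              ‖∑' m : ℤ, (if (N : ℤ) < |m| then g n m * ∑' l : ℤ, u (m - l) * v l else 0)‖ ^ 2) ∧
          (∑' n : ℤ, (n : ℝ) ^ 2 / (1 + (n : ℝ) ^ 2) ^ (2 - s) *
              ‖∑' m : ℤ, (if (N : ℤ) < |m| then g n m * ∑' l : ℤ, u (m - l) * v l else 0)‖ ^ 2)
            ≤ C * (N : ℝ) ^ (-(2 * s₁)) * G ^ 2 *
                (∑' n : ℤ, (1 + (n : ℝ) ^ 2) ^ s₁ * ‖u n‖ ^ 2) *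
                (∑' n : ℤ, (1 + (n : ℝ) ^ 2) ^ s₁ * ‖v n‖ ^ 2) := by
  refine ⟨(∑' n : ℤ, (n : ℝ) ^ 2 / (1 + (n : ℝ) ^ 2) ^ (2 - s)) + 1,
    add_pos_of_nonneg_of_pos (tsum_nonneg fun n => by positivity) one_pos, ?_⟩
  intro g G hg hG N hN u v hu hv
  have hK := summable_sq_div_weight hs
  have hconv := norm_convolution_le hs₁.le hu hv
  set U := ∑' n : ℤ, (1 + (n : ℝ) ^ 2) ^ s₁ * ‖u n‖ ^ 2
  set V := ∑' n : ℤ, (1 + (n : ℝ) ^ 2) ^ s₁ * ‖v n‖ ^ 2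
  have hU : 0 ≤ U := tsum_nonneg fun n => by positivity
  have hV : 0 ≤ V := tsum_nonneg fun n => by positivity
  have hNpos : (0 : ℝ) < N := by exact_mod_cast hN
  set B := (N : ℝ) ^ (-s₁) * (√U * √V)
  have hB : 0 ≤ B := by positivity
  have htail : ∀ m : ℤ, (N : ℤ) < |m| → ‖∑' l : ℤ, u (m - l) * v l‖ ≤ B := by
    intro m hm
    have hm' : (N : ℝ) ≤ |(m : ℝ)| := by exact_mod_cast hm.le
    have h : (N : ℝ) ^ s₁ * ‖∑' l : ℤ, u (m - l) * v l‖ ≤ √U * √V :=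
      (mul_le_mul_of_nonneg_right (Real.rpow_le_rpow hNpos.le hm' hs₁.le)
        (norm_nonneg _)).trans (hconv m)
    simp only [B]
    rwa [Real.rpow_neg hNpos.le, ← div_eq_inv_mul, le_div_iff₀' (by positivity)]
  have hc : ∀ n : ℤ, ‖∑' m : ℤ,
      (if (N : ℤ) < |m| then g n m * ∑' l : ℤ, u (m - l) * v l else 0)‖ ≤ G * B := by
    intro n
    refine (tsum_of_norm_bounded ((hg n).mul_right B).hasSum fun m => ?_).trans ?_
    · split_ifs with hm
      · rw [norm_mul]
        exact mul_le_mul_of_nonneg_left (htail m hm) (norm_nonneg _)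
      · rw [norm_zero]
        positivity
    · rw [tsum_mul_right]
      exact mul_le_mul_of_nonneg_right (hG n) hB
  have hBsq : B ^ 2 = (N : ℝ) ^ (-(2 * s₁)) * U * V := by
    simp only [B]
    rw [mul_pow, mul_pow, Real.sq_sqrt hU, Real.sq_sqrt hV, ← Real.rpow_natCast,
      ← Real.rpow_mul hNpos.le, ← mul_assoc]
    congr 3
    push_cast
    ring
  have hterm : ∀ n : ℤ, (n : ℝ) ^ 2 / (1 + (n : ℝ) ^ 2) ^ (2 - s) *
      ‖∑' m : ℤ, (if (N : ℤ) < |m| then g n m * ∑' l : ℤ, u (m - l) * v l else 0)‖ ^ 2 ≤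
      (n : ℝ) ^ 2 / (1 + (n : ℝ) ^ 2) ^ (2 - s) * (G * B) ^ 2 := fun n =>
    mul_le_mul_of_nonneg_left (pow_le_pow_left₀ (norm_nonneg _) (hc n) 2) (by positivity)
  have hsum := Summable.of_nonneg_of_le (fun n => by positivity) hterm (hK.mul_right _)
  refine ⟨hsum, (hsum.tsum_le_tsum hterm (hK.mul_right _)).trans ?_⟩
  rw [tsum_mul_right]
  calc (∑' n : ℤ, (n : ℝ) ^ 2 / (1 + (n : ℝ) ^ 2) ^ (2 - s)) * (G * B) ^ 2
      ≤ ((∑' n : ℤ, (n : ℝ) ^ 2 / (1 + (n : ℝ) ^ 2) ^ (2 - s)) + 1) * (G * B) ^ 2 := by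
        gcongr
        exact le_add_of_nonneg_right zero_le_one
    _ = _ := by rw [mul_pow, hBsq]; ring
end

section
/- Let V : ℤ → ℂ be a sequence with S := ∑_{k∈ℤ} √(2(1+k²)) |V_k| < ∞, and let u : ℤ → ℂ satisfy ∑_{n∈ℤ} |u_n|²/(1+n²) < ∞. Then for every n the sum (V⋆u)_n = ∑_{k∈ℤ} V_k u_{n−k} converges absolutely, and ∑_{n∈ℤ} (1/(1+n²)) |(V⋆u)_n|² ≤ S² ∑_{n∈ℤ} |u_n|²/(1+n²). -/
/-- Weighted Cauchy–Schwarz inequality for series with nonnegative weights. -/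
theorem summable_mul_and_sq_tsum_mul_le {ι : Type*} {a g : ι → ℝ} (ha : ∀ i, 0 ≤ a i)
    (hg : ∀ i, 0 ≤ g i) (hsa : Summable a) (hsg : Summable fun i => a i * g i ^ 2) :
    (Summable fun i => a i * g i) ∧
      (∑' i, a i * g i) ^ 2 ≤ (∑' i, a i) * ∑' i, a i * g i ^ 2 := by
  have h₁ : ∀ i, √(a i) ^ (2 : ℝ) = a i := fun i => by
    rw [Real.rpow_two, Real.sq_sqrt (ha i)]
  have h₂ : ∀ i, (√(a i) * g i) ^ (2 : ℝ) = a i * g i ^ 2 := fun i => by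
    rw [Real.rpow_two, mul_pow, Real.sq_sqrt (ha i)]
  have h₃ : ∀ i, √(a i) * (√(a i) * g i) = a i * g i := fun i => by
    rw [← mul_assoc, Real.mul_self_sqrt (ha i)]
  have key := Real.summable_and_inner_le_Lp_mul_Lq_tsum_of_nonneg Real.HolderConjugate.two_two
    (f := fun i => √(a i)) (g := fun i => √(a i) * g i)
    (fun i => Real.sqrt_nonneg _) (fun i => mul_nonneg (Real.sqrt_nonneg _) (hg i))
    (by simpa only [h₁] using hsa) (by simpa only [h₂] using hsg)
  simp only [h₁, h₂, h₃, ← Real.sqrt_eq_rpow] at key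
  refine ⟨key.1, ?_⟩
  have hA : 0 ≤ ∑' i, a i := tsum_nonneg ha
  have hB : 0 ≤ ∑' i, a i * g i ^ 2 := tsum_nonneg fun i => mul_nonneg (ha i) (sq_nonneg _)
  calc (∑' i, a i * g i) ^ 2 ≤ (√(∑' i, a i) * √(∑' i, a i * g i ^ 2)) ^ 2 :=
        pow_le_pow_left₀ (tsum_nonneg fun i => mul_nonneg (ha i) (hg i)) key.2 2
    _ = _ := by rw [mul_pow, Real.sq_sqrt hA, Real.sq_sqrt hB]

/-- Young's inequality `ℓ¹ ⋆ ℓ² ⊆ ℓ²` for nonnegative sequences on a commutative group. -/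
theorem summable_conv_and_tsum_sq_conv_le {G : Type*} [AddCommGroup G] {a f : G → ℝ}
    (ha : ∀ k, 0 ≤ a k) (hf : ∀ n, 0 ≤ f n) (hsa : Summable a)
    (hsf : Summable fun n => f n ^ 2) :
    (∀ n, Summable fun k => a k * f (n - k)) ∧
      (Summable fun n => (∑' k, a k * f (n - k)) ^ 2) ∧
      ∑' n, (∑' k, a k * f (n - k)) ^ 2 ≤ (∑' k, a k) ^ 2 * ∑' n, f n ^ 2 := by
  have hprod : Summable fun p : G × G => a p.1 * f (p.2 - p.1) ^ 2 := by
    have h := hsa.mul_of_nonneg hsf ha fun n => sq_nonneg (f n)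
    exact ((Equiv.prodShear (Equiv.refl G) fun k => Equiv.subRight k).summable_iff
      (f := fun p : G × G => a p.1 * f p.2 ^ 2)).2 h
  have hswap : Summable fun p : G × G => a p.2 * f (p.1 - p.2) ^ 2 :=
    (Equiv.prodComm G G).summable_iff.2 hprod
  have hcs n := summable_mul_and_sq_tsum_mul_le ha (fun k => hf (n - k)) hsa
    (hswap.prod_factor n)
  have hmaj : Summable fun n => (∑' k, a k) * ∑' k, a k * f (n - k) ^ 2 :=
    hswap.prod.mul_left _
  have hsq := Summable.of_nonneg_of_le (fun n => sq_nonneg _) (fun n => (hcs n).2) hmaj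
  refine ⟨fun n => (hcs n).1, hsq, (hsq.tsum_le_tsum (fun n => (hcs n).2) hmaj).trans_eq ?_⟩
  have hshift (k : G) : ∑' n, a k * f (n - k) ^ 2 = a k * ∑' n, f n ^ 2 := by
    rw [tsum_mul_left, ← (Equiv.subRight k).tsum_eq fun n => f n ^ 2]
    rfl
  rw [tsum_mul_left, Summable.tsum_comm (f := fun k n => a k * f (n - k) ^ 2) hprod,
    tsum_congr hshift, tsum_mul_right, sq, mul_assoc]

/-- Peetre's inequality. -/
theorem sqrt_one_add_sub_sq_le (x y : ℝ) :
    √(1 + (x - y) ^ 2) ≤ √(2 * (1 + y ^ 2)) * √(1 + x ^ 2) := by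
  rw [← Real.sqrt_mul (by positivity)]
  exact Real.sqrt_le_sqrt (by nlinarith [sq_nonneg (x + y), sq_nonneg (x * y)])

/-- If `S = ∑_k √(2(1+k²)) |V_k| < ∞` and `∑_n |u_n|²/(1+n²) < ∞`, then the convolution
`(V⋆u)_n = ∑_k V_k u_{n-k}` converges absolutely for every `n` and
`∑_n |(V⋆u)_n|²/(1+n²) ≤ S² ∑_n |u_n|²/(1+n²)`. -/
theorem stmt9 (V u : ℤ → ℂ)
    (hV : Summable fun k : ℤ => Real.sqrt (2 * (1 + (k : ℝ) ^ 2)) * ‖V k‖)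
    (hu : Summable fun n : ℤ => ‖u n‖ ^ 2 / (1 + (n : ℝ) ^ 2)) :
    (∀ n : ℤ, Summable fun k : ℤ => ‖V k * u (n - k)‖) ∧
    Summable (fun n : ℤ => ‖∑' k : ℤ, V k * u (n - k)‖ ^ 2 / (1 + (n : ℝ) ^ 2)) ∧
    (∑' n : ℤ, ‖∑' k : ℤ, V k * u (n - k)‖ ^ 2 / (1 + (n : ℝ) ^ 2))
      ≤ (∑' k : ℤ, Real.sqrt (2 * (1 + (k : ℝ) ^ 2)) * ‖V k‖) ^ 2 *
          (∑' n : ℤ, ‖u n‖ ^ 2 / (1 + (n : ℝ) ^ 2)) := by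
  set a : ℤ → ℝ := fun k => √(2 * (1 + (k : ℝ) ^ 2)) * ‖V k‖ with ha
  set f : ℤ → ℝ := fun n => ‖u n‖ / √(1 + (n : ℝ) ^ 2) with hf
  have hfsq (n : ℤ) : ‖u n‖ ^ 2 / (1 + (n : ℝ) ^ 2) = f n ^ 2 := by
    rw [hf, div_pow, Real.sq_sqrt (by positivity)]
  simp only [hfsq] at hu ⊢
  obtain ⟨hconv, hsq, hle⟩ := summable_conv_and_tsum_sq_conv_le (a := a) (f := f)
    (fun k => by positivity) (fun n => by positivity) hV hu
  have hpt (n k : ℤ) : ‖V k * u (n - k)‖ ≤ √(1 + (n : ℝ) ^ 2) * (a k * f (n - k)) := by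
    have hpos : 0 < √(1 + ((n : ℝ) - k) ^ 2) := Real.sqrt_pos.2 (by positivity)
    have h := mul_le_mul_of_nonneg_right (sqrt_one_add_sub_sq_le n k)
      (norm_nonneg (V k * u (n - k)))
    rw [← le_div_iff₀' hpos] at h
    refine h.trans_eq ?_
    simp only [ha, hf, norm_mul, Int.cast_sub]
    ring
  have hsum (n : ℤ) : Summable fun k : ℤ => ‖V k * u (n - k)‖ :=
    .of_nonneg_of_le (fun k => norm_nonneg _) (hpt n) ((hconv n).mul_left _)
  have hbound (n : ℤ) : ‖∑' k : ℤ, V k * u (n - k)‖ ^ 2 / (1 + (n : ℝ) ^ 2)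
      ≤ (∑' k, a k * f (n - k)) ^ 2 := by
    have h : ‖∑' k : ℤ, V k * u (n - k)‖ ≤ √(1 + (n : ℝ) ^ 2) * ∑' k, a k * f (n - k) := by
      rw [← tsum_mul_left]
      exact (norm_tsum_le_tsum_norm (hsum n)).trans
        ((hsum n).tsum_le_tsum (hpt n) ((hconv n).mul_left _))
    rw [div_le_iff₀' (by positivity)]
    refine (pow_le_pow_left₀ (norm_nonneg _) h 2).trans_eq ?_
    rw [mul_pow, Real.sq_sqrt (by positivity)]
  have hres := Summable.of_nonneg_of_le (fun n => by positivity) hbound hsq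
  exact ⟨hsum, hres, (hres.tsum_le_tsum hbound hsq).trans hle⟩
end

section
/- Let u : ℝ × ℝ → ℝ be three times continuously differentiable and 2π-periodic in its second (space) variable, and suppose u solves the Benjamin–Bona–Mahony equation: ∂_t u(t,x) − ∂_t ∂ₓ² u(t,x) + ∂ₓ u(t,x) + u(t,x) ∂ₓ u(t,x) = 0 for all (t,x) ∈ ℝ × ℝ. Then the energy t ↦ (1/2) ∫₀^{2π} ( u(t,x)² + (∂ₓ u(t,x))² ) dx is constant in t. -/
open Real

section PartialDerivatives

variable {f : ℝ × ℝ → ℝ}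

lemma hasDerivAt_fst_slice {p : ℝ × ℝ} (hf : DifferentiableAt ℝ f p) :
    HasDerivAt (fun τ => f (τ, p.2)) (fderiv ℝ f p (1, 0)) p.1 :=
  HasFDerivAt.comp_hasDerivAt (f := fun τ : ℝ => (τ, p.2)) p.1 hf.hasFDerivAt
    ((hasDerivAt_id p.1).prodMk (hasDerivAt_const p.1 p.2))

lemma hasDerivAt_snd_slice {p : ℝ × ℝ} (hf : DifferentiableAt ℝ f p) :
    HasDerivAt (fun y => f (p.1, y)) (fderiv ℝ f p (0, 1)) p.2 :=
  HasFDerivAt.comp_hasDerivAt (f := fun y : ℝ => (p.1, y)) p.2 hf.hasFDerivAt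
    ((hasDerivAt_const p.2 p.1).prodMk (hasDerivAt_id p.2))

lemma ContDiff.fderiv_apply_const {E F : Type*} [NormedAddCommGroup E] [NormedSpace ℝ E]
    [NormedAddCommGroup F] [NormedSpace ℝ F] {g : E → F} {m n : WithTop ℕ∞}
    (hg : ContDiff ℝ n g) (hmn : m + 1 ≤ n) (v : E) :
    ContDiff ℝ m (fun p => fderiv ℝ g p v) :=
  (hg.fderiv_right hmn).clm_apply contDiff_const

lemma ContDiff.fderiv_fderiv_apply_comm {E F : Type*} [NormedAddCommGroup E] [NormedSpace ℝ E]
    [NormedAddCommGroup F] [NormedSpace ℝ F] {g : E → F} (hg : ContDiff ℝ 2 g) (v w p : E) :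
    fderiv ℝ (fun q => fderiv ℝ g q v) p w = fderiv ℝ (fun q => fderiv ℝ g q w) p v := by
  have hd : DifferentiableAt ℝ (fderiv ℝ g) p :=
    (hg.fderiv_right (m := 1) (by norm_num)).differentiable (by norm_num) p
  rw [fderiv_clm_apply hd (differentiableAt_const v), fderiv_clm_apply hd (differentiableAt_const w)]
  simpa using hg.contDiffAt.isSymmSndFDerivAt (by simp) w v

end PartialDerivatives

/-- If `u` is `C³` and `2π`-periodic in space and solves the BBM equation
`∂ₜu - ∂ₜ∂ₓ²u + ∂ₓu + u ∂ₓu = 0`, then the energy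
`(1/2) ∫₀^{2π} (u² + (∂ₓu)²) dx` is constant in time. -/
theorem stmt13 (u : ℝ → ℝ → ℝ)
    (hu : ContDiff ℝ 3 (Function.uncurry u))
    (hper : ∀ t x : ℝ, u t (x + 2 * π) = u t x)
    (hPDE : ∀ t x : ℝ,
      deriv (fun τ => u τ x) t - deriv (fun τ => deriv (deriv (u τ)) x) t
        + deriv (u t) x + u t x * deriv (u t) x = 0) :
    ∀ t₁ t₂ : ℝ,
      (1 / 2) * ∫ x in (0 : ℝ)..(2 * π), (u t₁ x ^ 2 + (deriv (u t₁) x) ^ 2)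
        = (1 / 2) * ∫ x in (0 : ℝ)..(2 * π), (u t₂ x ^ 2 + (deriv (u t₂) x) ^ 2) := by
  intro t₁ t₂
  set U : ℝ × ℝ → ℝ := Function.uncurry u with hU
  set T : ℝ × ℝ → ℝ := fun p => fderiv ℝ U p (1, 0) with hT
  set X : ℝ × ℝ → ℝ := fun p => fderiv ℝ U p (0, 1) with hX
  set XT : ℝ × ℝ → ℝ := fun p => fderiv ℝ T p (0, 1) with hXT
  set XX : ℝ × ℝ → ℝ := fun p => fderiv ℝ X p (0, 1) with hXX
  have cT : ContDiff ℝ 2 T := hu.fderiv_apply_const (by norm_num) _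
  have cX : ContDiff ℝ 2 X := hu.fderiv_apply_const (by norm_num) _
  have cXT : ContDiff ℝ 1 XT := cT.fderiv_apply_const (by norm_num) _
  have cXX : ContDiff ℝ 1 XX := cX.fderiv_apply_const (by norm_num) _
  have dU : Differentiable ℝ U := hu.differentiable (by norm_num)
  have dT : Differentiable ℝ T := cT.differentiable (by norm_num)
  have dX : Differentiable ℝ X := cX.differentiable (by norm_num)
  have dXT : Differentiable ℝ XT := cXT.differentiable (by norm_num)
  have dXX : Differentiable ℝ XX := cXX.differentiable (by norm_num)
  have hTX : (fun p => fderiv ℝ X p (1, 0)) = XT :=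
    funext fun p => (hu.of_le (by norm_num)).fderiv_fderiv_apply_comm _ _ p
  have hTXX : ∀ p, fderiv ℝ XX p (1, 0) = fderiv ℝ XT p (0, 1) := fun p => by
    rw [← hTX]
    exact cX.fderiv_fderiv_apply_comm _ _ p
  have ux : ∀ t, deriv (u t) = fun x => X (t, x) := fun t =>
    funext fun x => (hasDerivAt_snd_slice (dU (t, x))).deriv
  have pde : ∀ t x, T (t, x) - fderiv ℝ XT (t, x) (0, 1) + X (t, x) + U (t, x) * X (t, x) = 0 := by
    intro t x
    have h := hPDE t x
    have h1 : deriv (fun τ => u τ x) t = T (t, x) := (hasDerivAt_fst_slice (dU (t, x))).deriv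
    have h2 : (fun τ => deriv (deriv (u τ)) x) = fun τ => XX (τ, x) := by
      funext τ
      rw [ux]
      exact (hasDerivAt_snd_slice (dX (τ, x))).deriv
    rw [h1, h2, (hasDerivAt_fst_slice (dXX (t, x))).deriv, hTXX, ux] at h
    exact h
  have perT : ∀ t x, T (t, x + 2 * π) = T (t, x) := fun t x => by
    refine (hasDerivAt_fst_slice (dU (t, x + 2 * π))).unique ?_
    simpa only [hU, Function.uncurry, hper] using hasDerivAt_fst_slice (dU (t, x))
  have perXT : ∀ t x, XT (t, x + 2 * π) = XT (t, x) := fun t x => by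
    refine HasDerivAt.unique
      ((hasDerivAt_snd_slice (dT (t, x + 2 * π))).comp_add_const x (2 * π)) ?_
    simpa only [perT] using hasDerivAt_snd_slice (dT (t, x))
  -- the time derivative of the energy density, which is an exact space derivative
  set g : ℝ → ℝ → ℝ := fun t x => 2 * U (t, x) * T (t, x) + 2 * X (t, x) * XT (t, x) with hg
  have cg : Continuous (Function.uncurry g) := by
    have := hu.continuous
    have := cT.continuous
    have := cX.continuous
    have := cXT.continuous
    simp only [hg, Function.uncurry_def]
    fun_prop
  have g_time : ∀ x, ∫ t in t₁..t₂, g t x =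
      (u t₂ x ^ 2 + deriv (u t₂) x ^ 2) - (u t₁ x ^ 2 + deriv (u t₁) x ^ 2) := by
    intro x
    simp only [ux]
    refine intervalIntegral.integral_eq_sub_of_hasDerivAt
      (f := fun t => u t x ^ 2 + X (t, x) ^ 2) (fun t _ => ?_)
      (Continuous.intervalIntegrable (by exact cg.comp (by fun_prop : Continuous fun t => (t, x))) _ _)
    have h1 : HasDerivAt (fun τ => u τ x) (T (t, x)) t := hasDerivAt_fst_slice (dU (t, x))
    have h2 : HasDerivAt (fun τ => X (τ, x)) (XT (t, x)) t := by
      rw [← hTX]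
      exact hasDerivAt_fst_slice (dX (t, x))
    refine ((h1.pow 2).add (h2.pow 2)).congr_deriv ?_
    simp [hg, hU]
  have g_space : ∀ t, ∫ x in (0 : ℝ)..(2 * π), g t x = 0 := by
    intro t
    rw [intervalIntegral.integral_eq_sub_of_hasDerivAt
      (f := fun x => 2 * (U (t, x) * XT (t, x)) - U (t, x) ^ 2 - 2 / 3 * U (t, x) ^ 3)
      (fun x _ => ?_) (Continuous.intervalIntegrable
        (by exact cg.comp (by fun_prop : Continuous fun x => (t, x))) _ _)]
    · have h1 := perXT t 0
      have h2 : U (t, 0 + 2 * π) = U (t, 0) := hper t 0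
      rw [zero_add] at h1 h2
      simp only [h1, h2, sub_self]
    · have h1 : HasDerivAt (fun y => U (t, y)) (X (t, x)) x := hasDerivAt_snd_slice (dU (t, x))
      have h2 : HasDerivAt (fun y => XT (t, y)) (fderiv ℝ XT (t, x) (0, 1)) x :=
        hasDerivAt_snd_slice (dXT (t, x))
      refine ((((h1.mul h2).const_mul 2).sub (h1.pow 2)).sub
        ((h1.pow 3).const_mul (2 / 3))).congr_deriv ?_
      simp only [hg]
      push_cast
      linear_combination -2 * U (t, x) * pde t x
  have cE : ∀ t, IntervalIntegrable (fun x => u t x ^ 2 + deriv (u t) x ^ 2)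
      MeasureTheory.volume 0 (2 * π) := fun t => by
    rw [ux]
    have h1 : Continuous fun x => u t x :=
      hu.continuous.comp (by fun_prop : Continuous fun x => (t, x))
    have h2 := cX.continuous
    exact Continuous.intervalIntegrable (by fun_prop) _ _
  have key : ∫ t in t₁..t₂, ∫ x in (0 : ℝ)..(2 * π), g t x =
      ∫ x in (0 : ℝ)..(2 * π), ∫ t in t₁..t₂, g t x :=
    MeasureTheory.intervalIntegral_intervalIntegral_swap
      ((cg.continuousOn.integrableOn_compact (isCompact_uIcc.prod isCompact_uIcc)).mono_set
        (Set.prod_mono Set.uIoc_subset_uIcc Set.uIoc_subset_uIcc))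
  simp only [g_space, g_time, intervalIntegral.integral_zero] at key
  rw [intervalIntegral.integral_sub (cE t₂) (cE t₁)] at key
  linarith
end

section
/- There exists a constant C₀ > 0 with the following property: for every R > 0, every c⁰ ∈ ℓ²(ℤ, ℂ) with ‖c⁰‖₂ ≤ R, and every T with 0 < T < 1/(C₀ R), there exists a unique continuous map c : [−T, T] → ℓ²(ℤ, ℂ) with sup_{|t|≤T} ‖c(t)‖₂ ≤ 2R such that for all t ∈ [−T, T] and all n ∈ ℤ, c_n(t) = e^{−i n t/(1+n²)} c⁰_n − (i n / (2(1+n²))) ∫₀^t e^{−i n (t−s)/(1+n²)} ( ∑_{l∈ℤ} c_{n−l}(s) c_l(s) ) ds, where the convolution sum converges absolutely (bounded by ‖c(s)‖₂²). (This is the Duhamel fixed-point formulation, in Fourier coefficients, of local well-posedness of the periodic BBM equation ∂_t(1−∂ₓ²)u + ∂ₓ(u + u²/2) = 0 in L².) -/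
open scoped lp

namespace BBM

/-- The frequency `n / (1 + n²)` of the `n`-th mode of the linear BBM group. -/
noncomputable def freq (n : ℤ) : ℝ := n / (1 + (n : ℝ) ^ 2)

/-- The factor `e^{-int/(1+n²)}` by which the linear BBM group acts on the `n`-th mode. -/
noncomputable def phase (t : ℝ) (n : ℤ) : ℂ :=
  Complex.exp (Complex.I * ((-(freq n * t) : ℝ) : ℂ))

theorem abs_freq_le_one (n : ℤ) : |freq n| ≤ 1 := by
  rw [freq, abs_div, abs_of_pos (by positivity : (0 : ℝ) < 1 + (n : ℝ) ^ 2),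
    div_le_one (by positivity)]
  nlinarith [sq_nonneg (|(n : ℝ)| - 1), sq_abs (n : ℝ), abs_nonneg (n : ℝ)]

theorem exp_eq_phase (t : ℝ) (n : ℤ) :
    Complex.exp (-Complex.I * (n : ℂ) * (t : ℂ) / (1 + (n : ℂ) ^ 2)) = phase t n := by
  rw [phase, freq]
  congr 1
  push_cast
  ring

@[simp]
theorem norm_phase (t : ℝ) (n : ℤ) : ‖phase t n‖ = 1 :=
  Complex.norm_exp_I_mul_ofReal _

theorem phase_add (s t : ℝ) (n : ℤ) : phase (s + t) n = phase s n * phase t n := by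
  rw [phase, phase, phase, ← Complex.exp_add]
  congr 1
  push_cast
  ring

@[simp]
theorem phase_zero (n : ℤ) : phase 0 n = 1 := by simp [phase]

theorem norm_phase_sub_le (s t : ℝ) (n : ℤ) : ‖phase s n - phase t n‖ ≤ |s - t| := by
  have h : phase s n - phase t n = phase t n * (phase (s - t) n - 1) := by
    rw [mul_sub, ← phase_add, add_sub_cancel, mul_one]
  rw [h, norm_mul, norm_phase, one_mul]
  refine (Real.norm_exp_I_mul_ofReal_sub_one_le).trans ?_
  rw [norm_neg, Real.norm_eq_abs, abs_mul]
  exact mul_le_of_le_one_left (abs_nonneg _) (abs_freq_le_one n)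

/-- The linear BBM group on `ℓ²`. -/
noncomputable def group (t : ℝ) : ℓ²(ℤ, ℂ) →L[ℂ] ℓ²(ℤ, ℂ) :=
  LinearMap.mkContinuous
    { toFun := fun a => ⟨fun n => phase t n * a n, (lp.memℓp a).mono' fun n => by simp⟩
      map_add' := fun a b => by ext n; exact mul_add _ _ _
      map_smul' := fun z a => by ext n; simp [mul_left_comm] }
    1 fun a => by
      rw [one_mul]
      exact lp.norm_mono two_ne_zero fun n => by simp

@[simp]
theorem group_apply (t : ℝ) (a : ℓ²(ℤ, ℂ)) (n : ℤ) : group t a n = phase t n * a n := rfl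

theorem norm_group (t : ℝ) (a : ℓ²(ℤ, ℂ)) : ‖group t a‖ = ‖a‖ :=
  le_antisymm (lp.norm_mono two_ne_zero fun n => by simp)
    (lp.norm_mono two_ne_zero fun n => by simp)

theorem group_group_neg (t : ℝ) (a : ℓ²(ℤ, ℂ)) : group t (group (-t) a) = a := by
  ext n
  rw [group_apply, group_apply, ← mul_assoc, ← phase_add, add_neg_cancel, phase_zero, one_mul]

theorem group_neg_group (t : ℝ) (a : ℓ²(ℤ, ℂ)) : group (-t) (group t a) = a := by
  simpa using group_group_neg (-t) a

theorem norm_group_sub_le (s t : ℝ) (a : ℓ²(ℤ, ℂ)) :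
    ‖group s a - group t a‖ ≤ |s - t| * ‖a‖ := by
  have h : ‖((s - t : ℝ) : ℂ) • a‖ = |s - t| * ‖a‖ := by
    rw [norm_smul, Complex.norm_real, Real.norm_eq_abs]
  rw [← h]
  refine lp.norm_mono two_ne_zero fun n => ?_
  rw [lp.coeFn_sub, Pi.sub_apply, group_apply, group_apply, ← sub_mul, norm_mul, lp.coeFn_smul,
    Pi.smul_apply, norm_smul, Complex.norm_real, Real.norm_eq_abs]
  exact mul_le_mul_of_nonneg_right (norm_phase_sub_le s t n) (norm_nonneg _)

theorem continuous_group : Continuous fun p : ℝ × ℓ²(ℤ, ℂ) => group p.1 p.2 := by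
  refine continuous_prod_of_continuous_lipschitzWith' _ 1 (fun t => ?_) fun a => ?_
  · refine LipschitzWith.of_dist_le_mul fun x y => ?_
    rw [dist_eq_norm, dist_eq_norm, ← map_sub, norm_group, NNReal.coe_one, one_mul]
  · refine (LipschitzWith.of_dist_le_mul (K := ‖a‖₊) fun s t => ?_).continuous
    rw [dist_eq_norm, Real.dist_eq, mul_comm]
    exact norm_group_sub_le s t a

theorem continuousOn_group_neg {c : ℝ → ℓ²(ℤ, ℂ)} {u : Set ℝ} (hc : ContinuousOn c u) :
    ContinuousOn (fun s => group (-s) (c s)) u := by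
  have h : ContinuousOn (fun s => (-s, c s)) u := by fun_prop
  exact (continuous_group.comp_continuousOn h :)

/-- The composition of a sequence with the reflection `l ↦ n - l`. -/
noncomputable def reflect (n : ℤ) (a : ℓ²(ℤ, ℂ)) : ℓ²(ℤ, ℂ) :=
  ⟨fun l => a (n - l), (memℓp_gen_iff (by simp)).2
    ((Equiv.subLeft n).summable_iff.2 ((lp.memℓp a).summable (by simp)))⟩

theorem norm_reflect (n : ℤ) (a : ℓ²(ℤ, ℂ)) : ‖reflect n a‖ = ‖a‖ := by
  rw [lp.norm_eq_tsum_rpow (by simp), lp.norm_eq_tsum_rpow (by simp)]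
  congr 1
  exact (Equiv.subLeft n).tsum_eq fun l => ‖a l‖ ^ (2 : ENNReal).toReal

theorem summable_norm_conv_and_tsum_le (a b : ℓ²(ℤ, ℂ)) (n : ℤ) :
    (Summable fun l : ℤ => ‖a (n - l) * b l‖) ∧
      ∑' l : ℤ, ‖a (n - l) * b l‖ ≤ ‖a‖ * ‖b‖ := by
  have hpq : (2 : ENNReal).toReal.HolderConjugate (2 : ENNReal).toReal := by
    rw [Real.holderConjugate_iff]
    norm_num
  simpa only [norm_mul, norm_reflect] using! lp.tsum_mul_le_mul_norm hpq (reflect n a) b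

theorem summable_conv (a b : ℓ²(ℤ, ℂ)) (n : ℤ) : Summable fun l : ℤ => a (n - l) * b l :=
  (summable_norm_conv_and_tsum_le a b n).1.of_norm

theorem norm_conv_le (a b : ℓ²(ℤ, ℂ)) (n : ℤ) : ‖∑' l : ℤ, a (n - l) * b l‖ ≤ ‖a‖ * ‖b‖ :=
  (norm_tsum_le_tsum_norm (summable_norm_conv_and_tsum_le a b n).1).trans
    (summable_norm_conv_and_tsum_le a b n).2

/-- The symbol `in / (2(1+n²))` of the operator `(1 - ∂ₓ²)⁻¹ ∂ₓ / 2`, a square-summable sequence. -/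
noncomputable def symbol : ℓ²(ℤ, ℂ) :=
  ⟨fun n => Complex.I * (n : ℂ) / (2 * (1 + (n : ℂ) ^ 2)), by
    refine (memℓp_gen_iff (by simp)).2 ?_
    refine Summable.of_nonneg_of_le (fun n => by positivity) (fun n => ?_)
      (Real.summable_one_div_int_pow.2 one_lt_two)
    have h : ‖Complex.I * (n : ℂ) / (2 * (1 + (n : ℂ) ^ 2))‖
        = |(n : ℝ)| / (2 * (1 + (n : ℝ) ^ 2)) := by
      have h' : (2 * (1 + (n : ℂ) ^ 2)) = ((2 * (1 + (n : ℝ) ^ 2) : ℝ) : ℂ) := by push_cast; rfl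
      rw [h', norm_div, norm_mul, Complex.norm_I, one_mul, Complex.norm_real, Complex.norm_intCast,
        Real.norm_of_nonneg (by positivity)]
    rw [h, ENNReal.toReal_ofNat, Real.rpow_two, div_pow, sq_abs]
    rcases eq_or_ne n 0 with rfl | hn
    · simp
    have hn' : (0 : ℝ) < (n : ℝ) ^ 2 := by positivity
    rw [div_le_div_iff₀ (by positivity) hn']
    nlinarith⟩

theorem symbol_apply (n : ℤ) :
    symbol n = Complex.I * (n : ℂ) / (2 * (1 + (n : ℂ) ^ 2)) := rfl

theorem norm_symbol_mul_conv_le (a b : ℓ²(ℤ, ℂ)) (n : ℤ) :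
    ‖symbol n * ∑' l : ℤ, a (n - l) * b l‖ ≤ ‖(((‖a‖ * ‖b‖ : ℝ) : ℂ) • symbol) n‖ := by
  rw [lp.coeFn_smul, Pi.smul_apply, norm_smul, norm_mul, Complex.norm_real,
    Real.norm_of_nonneg (by positivity), mul_comm]
  exact mul_le_mul_of_nonneg_right (norm_conv_le a b n) (norm_nonneg _)

/-- The bilinear map `(u, v) ↦ (1 - ∂ₓ²)⁻¹ ∂ₓ (u v) / 2` in Fourier coefficients. -/
noncomputable def bilin : ℓ²(ℤ, ℂ) →L[ℂ] ℓ²(ℤ, ℂ) →L[ℂ] ℓ²(ℤ, ℂ) :=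
  LinearMap.mkContinuous₂
    (LinearMap.mk₂ ℂ
      (fun a b => ⟨fun n => symbol n * ∑' l : ℤ, a (n - l) * b l,
        (lp.memℓp _).mono' (norm_symbol_mul_conv_le a b)⟩)
      (fun a a' b => by
        ext n
        refine Eq.trans ?_ (mul_add _ _ _)
        simp [add_mul, (summable_conv a b n).tsum_add (summable_conv a' b n)])
      (fun z a b => by ext n; simp [mul_assoc, tsum_mul_left, mul_left_comm])
      (fun a b b' => by
        ext n
        refine Eq.trans ?_ (mul_add _ _ _)
        simp [mul_add, (summable_conv a b n).tsum_add (summable_conv a b' n)])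
      (fun z a b => by ext n; simp [tsum_mul_left, mul_left_comm]))
    ‖symbol‖ fun a b => by
      refine (lp.norm_mono two_ne_zero (norm_symbol_mul_conv_le a b)).trans_eq ?_
      rw [norm_smul, Complex.norm_real, Real.norm_of_nonneg (by positivity)]
      ring

theorem bilin_apply (a b : ℓ²(ℤ, ℂ)) (n : ℤ) :
    bilin a b n = symbol n * ∑' l : ℤ, a (n - l) * b l := rfl

theorem norm_bilin_le (a b : ℓ²(ℤ, ℂ)) : ‖bilin a b‖ ≤ ‖symbol‖ * ‖a‖ * ‖b‖ :=
  (bilin.le_opNorm₂ a b).trans <| by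
    gcongr
    exact LinearMap.mkContinuous₂_norm_le _ (norm_nonneg _) _

/-- The BBM nonlinearity in the frame moving with the linear group. -/
noncomputable def field (t : ℝ) (x : ℓ²(ℤ, ℂ)) : ℓ²(ℤ, ℂ) :=
  -group (-t) (bilin (group t x) (group t x))

theorem continuous_field : Continuous (Function.uncurry field) := by
  have h := continuous_group
  have h' : Continuous fun p : ℝ × ℓ²(ℤ, ℂ) => bilin (group p.1 p.2) (group p.1 p.2) :=
    (bilin.continuous.comp h).clm_apply h
  exact (h.comp (continuous_fst.neg.prodMk h')).neg

theorem norm_field_le (t : ℝ) (x : ℓ²(ℤ, ℂ)) : ‖field t x‖ ≤ ‖symbol‖ * ‖x‖ * ‖x‖ := by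
  rw [field, norm_neg, norm_group]
  simpa only [norm_group] using norm_bilin_le (group t x) (group t x)

theorem norm_field_sub_le (t : ℝ) (x y : ℓ²(ℤ, ℂ)) :
    ‖field t x - field t y‖ ≤ ‖symbol‖ * (‖x‖ + ‖y‖) * ‖x - y‖ := by
  have h : field t x - field t y = -group (-t) (bilin (group t (x - y)) (group t x)
      + bilin (group t y) (group t (x - y))) := by
    simp only [field, map_sub, map_add, sub_apply]
    abel
  rw [h, norm_neg, norm_group]
  refine (norm_add_le _ _).trans ((add_le_add (norm_bilin_le _ _) (norm_bilin_le _ _)).trans_eq ?_)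
  simp only [norm_group]
  ring

theorem lipschitzOnWith_field (t : ℝ) (r : NNReal) :
    LipschitzOnWith (‖symbol‖₊ * (r + r)) (field t) (Metric.closedBall 0 r) := by
  refine LipschitzOnWith.of_dist_le_mul fun x hx y hy => ?_
  rw [mem_closedBall_zero_iff] at hx hy
  rw [dist_eq_norm, dist_eq_norm]
  refine (norm_field_sub_le t x y).trans ?_
  push_cast
  gcongr

theorem field_group_neg_apply (t : ℝ) (x : ℓ²(ℤ, ℂ)) (n : ℤ) :
    field t (group (-t) x) n = -(phase (-t) n * (symbol n * ∑' l : ℤ, x (n - l) * x l)) := by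
  rw [field, group_group_neg, lp.coeFn_neg, Pi.neg_apply, group_apply, bilin_apply]

/-- In the moving frame, the Duhamel formula is the Picard integral equation of `field`. -/
theorem group_picard_apply {c : ℝ → ℓ²(ℤ, ℂ)} {T t : ℝ} (hc : ContinuousOn c (Set.Icc (-T) T))
    (ht : t ∈ Set.Icc (-T) T) (c₀ : ℓ²(ℤ, ℂ)) (n : ℤ) :
    group t (ODE.picard field 0 c₀ (fun s => group (-s) (c s)) t) n
      = Complex.exp (-Complex.I * (n : ℂ) * (t : ℂ) / (1 + (n : ℂ) ^ 2)) * c₀ n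
        - (Complex.I * (n : ℂ) / (2 * (1 + (n : ℂ) ^ 2))) *
            ∫ s in (0 : ℝ)..t,
              Complex.exp (-Complex.I * (n : ℂ) * ((t : ℂ) - (s : ℂ)) / (1 + (n : ℂ) ^ 2)) *
                ∑' l : ℤ, (c s (n - l) : ℂ) * c s l := by
  have hd' : ContinuousOn (fun s => (s, group (-s) (c s))) (Set.Icc (-T) T) :=
    continuousOn_id.prodMk (continuousOn_group_neg hc)
  have hd : ContinuousOn (fun s => field s (group (-s) (c s))) (Set.Icc (-T) T) :=
    (continuous_field.comp_continuousOn hd' :)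
  have h0 : (0 : ℝ) ∈ Set.Icc (-T) T := by
    constructor <;> linarith [ht.1, ht.2]
  have hint : IntervalIntegrable (fun s => field s (group (-s) (c s))) MeasureTheory.volume 0 t :=
    (hd.mono (Set.uIcc_subset_Icc h0 ht)).intervalIntegrable
  have hcomm := (lp.evalCLM ℝ (fun _ : ℤ => ℂ) 2 n).intervalIntegral_comp_comm hint
  have hcomm' : (∫ s in (0 : ℝ)..t, field s (group (-s) (c s))) n
      = ∫ s in (0 : ℝ)..t, field s (group (-s) (c s)) n := hcomm.symm
  rw [group_apply, ODE.picard_apply, lp.coeFn_add, Pi.add_apply, hcomm', mul_add, exp_eq_phase,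
    sub_eq_add_neg, ← symbol_apply, ← intervalIntegral.integral_const_mul,
    ← intervalIntegral.integral_const_mul, ← intervalIntegral.integral_neg]
  congr 1
  refine intervalIntegral.integral_congr fun s _ => ?_
  simp only [field_group_neg_apply]
  rw [← Complex.ofReal_sub, exp_eq_phase, sub_eq_add_neg t s, phase_add]
  ring

/-- Curves in the ball of radius `r` solving the Picard integral equation of `field` agree. -/
theorem eqOn_of_eq_picard {d d' : ℝ → ℓ²(ℤ, ℂ)} {T : ℝ} (hT : 0 < T) {r : NNReal}
    {c₀ : ℓ²(ℤ, ℂ)} (hd : ContinuousOn d (Set.Icc (-T) T))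
    (hd' : ContinuousOn d' (Set.Icc (-T) T))
    (hr : ∀ t ∈ Set.Icc (-T) T, ‖d t‖ ≤ r) (hr' : ∀ t ∈ Set.Icc (-T) T, ‖d' t‖ ≤ r)
    (heq : ∀ t ∈ Set.Icc (-T) T, d t = ODE.picard field 0 c₀ d t)
    (heq' : ∀ t ∈ Set.Icc (-T) T, d' t = ODE.picard field 0 c₀ d' t) :
    Set.EqOn d d' (Set.Icc (-T) T) := by
  have h0 : (0 : ℝ) ∈ Set.Ioo (-T) T := by simpa using hT
  have key : ∀ e : ℝ → ℓ²(ℤ, ℂ), ContinuousOn e (Set.Icc (-T) T) →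
      (∀ t ∈ Set.Icc (-T) T, e t = ODE.picard field 0 c₀ e t) →
      ∀ t ∈ Set.Ioo (-T) T, HasDerivAt e (field t (e t)) t := by
    intro e he heq t ht
    have ht' := Set.Ioo_subset_Icc_self ht
    have h := ODE.hasDerivWithinAt_picard_Icc (u := Set.univ) (Set.Ioo_subset_Icc_self h0)
      continuous_field.continuousOn he (fun _ _ => Set.mem_univ _) c₀ ht'
    exact (h.congr heq (heq t ht')).hasDerivAt (Icc_mem_nhds ht.1 ht.2)
  refine ODE_solution_unique_of_mem_Icc (fun t _ => lipschitzOnWith_field t r) h0 hd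
    (key d hd heq) (fun t ht => ?_) hd' (key d' hd' heq') (fun t ht => ?_) ?_
  · exact mem_closedBall_zero_iff.2 (hr t (Set.Ioo_subset_Icc_self ht))
  · exact mem_closedBall_zero_iff.2 (hr' t (Set.Ioo_subset_Icc_self ht))
  · rw [heq 0 (Set.Ioo_subset_Icc_self h0), heq' 0 (Set.Ioo_subset_Icc_self h0),
      ODE.picard_apply₀, ODE.picard_apply₀]

theorem exists_eq_picard {R T : ℝ} (hR : 0 < R) (hT : 0 < T) {c₀ : ℓ²(ℤ, ℂ)} (hc₀ : ‖c₀‖ ≤ R)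
    (hRT : 4 * ‖symbol‖ * R * T ≤ 1) :
    ∃ d : ℝ → ℓ²(ℤ, ℂ), Continuous d ∧ (∀ t, ‖d t‖ ≤ 2 * R) ∧
      ∀ t ∈ Set.Icc (-T) T, d t = ODE.picard field 0 c₀ d t := by
  lift R to NNReal using hR.le
  have hball : ∀ x ∈ Metric.closedBall c₀ (R : ℝ), ‖x‖ ≤ 2 * R := fun x hx => by
    have h := norm_le_norm_add_norm_sub' x c₀
    rw [mem_closedBall_iff_norm] at hx
    linarith
  have h0 : (0 : ℝ) ∈ Set.Icc (-T) T := by constructor <;> linarith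
  have hf : IsPicardLindelof field (⟨0, h0⟩ : Set.Icc (-T) T) c₀ R 0
      (‖symbol‖₊ * (2 * R) * (2 * R)) (‖symbol‖₊ * (2 * R + 2 * R)) := by
    refine ⟨fun t _ => (lipschitzOnWith_field t (2 * R)).mono fun x hx => ?_, fun x _ => ?_,
      fun t _ x hx => ?_, ?_⟩
    · exact mem_closedBall_zero_iff.2 (by simpa using hball x hx)
    · exact (continuous_field.comp (continuous_id.prodMk continuous_const)).continuousOn
    · refine (norm_field_le t x).trans ?_
      have := hball x hx
      push_cast
      gcongr
    · push_cast
      rw [sub_zero, zero_sub, neg_neg, max_self, sub_zero]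
      nlinarith [mul_le_mul_of_nonneg_left hRT hR.le]
  have hx : c₀ ∈ Metric.closedBall c₀ ((0 : NNReal) : ℝ) := Metric.mem_closedBall_self le_rfl
  obtain ⟨α, hα⟩ := ODE.FunSpace.exists_isFixedPt_next hf hx
  refine ⟨α.compProj, α.continuous_compProj,
    fun t => hball _ (α.compProj_mem_closedBall hf.mul_max_le), fun t ht => ?_⟩
  rw [ODE.FunSpace.compProj_of_mem ht]
  exact (ODE.FunSpace.isFixedPt_next_iff hf hx).1 hα ⟨t, ht⟩

end BBM

open scoped ComplexConjugate

/-- Local well-posedness of periodic BBM in `L²`, Duhamel fixed-point form in Fourier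
coefficients: there is `C₀ > 0` such that for every `R > 0`, every `c⁰ ∈ ℓ²(ℤ,ℂ)` with
`‖c⁰‖ ≤ R` and every `0 < T < 1/(C₀R)` there is a unique continuous `c : [-T,T] → ℓ²` with
`sup ‖c(t)‖ ≤ 2R` solving
`c_n(t) = e^{-int/(1+n²)} c⁰_n - (in/(2(1+n²))) ∫₀ᵗ e^{-in(t-s)/(1+n²)} (c(s)⋆c(s))_n ds`,
the convolution converging absolutely with sum bounded by `‖c(s)‖²`. -/
theorem stmt17 : ∃ C₀ : ℝ, 0 < C₀ ∧
    ∀ (R : ℝ), 0 < R →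
    ∀ c₀ : lp (fun _ : ℤ => ℂ) 2, ‖c₀‖ ≤ R →
    ∀ T : ℝ, 0 < T → T < 1 / (C₀ * R) →
      ∃ c : ℝ → lp (fun _ : ℤ => ℂ) 2,
        (ContinuousOn c (Set.Icc (-T) T) ∧
          (∀ t ∈ Set.Icc (-T) T, ‖c t‖ ≤ 2 * R) ∧
          (∀ t ∈ Set.Icc (-T) T, ∀ n : ℤ,
            (Summable fun l : ℤ => ‖(c t (n - l) : ℂ) * c t l‖) ∧
            (∑' l : ℤ, ‖(c t (n - l) : ℂ) * c t l‖) ≤ ‖c t‖ ^ 2 ∧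
            c t n
              = Complex.exp (-Complex.I * (n : ℂ) * (t : ℂ) / (1 + (n : ℂ) ^ 2)) * c₀ n
                - (Complex.I * (n : ℂ) / (2 * (1 + (n : ℂ) ^ 2))) *
                    ∫ s in (0 : ℝ)..t,
                      Complex.exp (-Complex.I * (n : ℂ) * ((t : ℂ) - (s : ℂ)) /
                          (1 + (n : ℂ) ^ 2)) *
                        ∑' l : ℤ, (c s (n - l) : ℂ) * c s l)) ∧
        (∀ c' : ℝ → lp (fun _ : ℤ => ℂ) 2,
          (ContinuousOn c' (Set.Icc (-T) T) ∧
            (∀ t ∈ Set.Icc (-T) T, ‖c' t‖ ≤ 2 * R) ∧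
            (∀ t ∈ Set.Icc (-T) T, ∀ n : ℤ,
              (Summable fun l : ℤ => ‖(c' t (n - l) : ℂ) * c' t l‖) ∧
              (∑' l : ℤ, ‖(c' t (n - l) : ℂ) * c' t l‖) ≤ ‖c' t‖ ^ 2 ∧
              c' t n
                = Complex.exp (-Complex.I * (n : ℂ) * (t : ℂ) / (1 + (n : ℂ) ^ 2)) * c₀ n
                  - (Complex.I * (n : ℂ) / (2 * (1 + (n : ℂ) ^ 2))) *
                      ∫ s in (0 : ℝ)..t,
                        Complex.exp (-Complex.I * (n : ℂ) * ((t : ℂ) - (s : ℂ)) /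
                            (1 + (n : ℂ) ^ 2)) *
                          ∑' l : ℤ, (c' s (n - l) : ℂ) * c' s l)) →
          ∀ t ∈ Set.Icc (-T) T, c' t = c t) := by
  refine ⟨4 * ‖BBM.symbol‖ + 1, by positivity, fun R hR c₀ hc₀ T hT hTR => ?_⟩
  have hRT : 4 * ‖BBM.symbol‖ * R * T ≤ 1 := by
    rw [lt_div_iff₀ (by positivity)] at hTR
    nlinarith [mul_pos hT hR]
  obtain ⟨d, hd, hdR, hdeq⟩ := BBM.exists_eq_picard hR hT hc₀ hRT
  have hc : Continuous fun t => BBM.group t (d t) :=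
    BBM.continuous_group.comp (continuous_id.prodMk hd)
  refine ⟨fun t => BBM.group t (d t), ⟨hc.continuousOn, fun t _ => ?_, fun t ht n => ?_⟩, ?_⟩
  · rw [BBM.norm_group]
    exact hdR t
  · refine ⟨(BBM.summable_norm_conv_and_tsum_le _ _ n).1,
      (BBM.summable_norm_conv_and_tsum_le _ _ n).2.trans_eq (sq _).symm, ?_⟩
    rw [← BBM.group_picard_apply hc.continuousOn ht]
    simp only [BBM.group_neg_group]
    rw [← hdeq t ht]
  · rintro c' ⟨hc', hc'R, hc'eq⟩ t ht
    have hd' : ContinuousOn (fun s => BBM.group (-s) (c' s)) (Set.Icc (-T) T) :=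
      BBM.continuousOn_group_neg hc'
    have h := BBM.eqOn_of_eq_picard hT (r := ⟨2 * R, by positivity⟩) (c₀ := c₀) hd' hd.continuousOn
      (fun s hs => (BBM.norm_group _ _).trans_le (hc'R s hs)) (fun s _ => hdR s)
      (fun s hs => ?_) hdeq ht
    · change c' t = BBM.group t (d t)
      rw [← h, BBM.group_group_neg]
    · have hs' : c' s = BBM.group s (ODE.picard BBM.field 0 c₀
          (fun s => BBM.group (-s) (c' s)) s) := by
        ext n
        rw [BBM.group_picard_apply hc' hs]
        exact (hc'eq s hs n).2.2
      nth_rw 1 [hs']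
      rw [BBM.group_neg_group]
end
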